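/- arXiv:1512.03084 — 8 statements merged into one kernel-verified Lean document; each statement's English description precedes it below -/
import Mathlib

section
/- Let E ≥ 1, let k, j : Fin E → ℕ be degree label functions, and let Q : ℕ × ℕ → ℝ be nonnegative. Then the double permutation sum ∑_{σ,τ ∈ Perm(Fin E)} ∏_{ℓ ∈ Fin E} Q(k(σ(ℓ)), j(τ(ℓ))) equals E! · ∑_e ( ∏_{(k',j')} Q(k',j')^{e(k',j')} / e(k',j')! ) · ( ∏_{j'} e⁻_{j'}! ) · ( ∏_{k'} e⁺_{k'}! ), where the sum runs over all finitely supported matrices e : ℕ × ℕ → ℕ satisfying the margin constraints ∑_{j'} e(k',j') = e⁺_{k'} for every k' and ∑_{k'} e(k',j') = e⁻_{j'} for every j'. -/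
open scoped BigOperators

/-- The number of stubs with degree label `d`. -/
def stubCount (E : ℕ) (f : Fin E → ℕ) (d : ℕ) : ℕ :=
  (Finset.univ.filter fun ℓ => f ℓ = d).card

/-- Multiset of values of a tuple. -/
def tupleMs {α : Type*} {E : ℕ} (g : Fin E → α) : Multiset α := Finset.univ.val.map g

theorem count_tupleMs {α : Type*} [DecidableEq α] {E : ℕ} (g : Fin E → α) (a : α) :
    (tupleMs g).count a = Fintype.card {x // g x = a} := by
  rw [tupleMs, Multiset.count_map, Fintype.card_subtype, Finset.card_def, Finset.filter_val]
  simp only [eq_comm]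

theorem stubCount_eq {E : ℕ} (f : Fin E → ℕ) (d : ℕ) :
    stubCount E f d = (tupleMs f).count d := by
  rw [count_tupleMs, Fintype.card_subtype, stubCount]

theorem tupleMs_comp {α : Type*} {E : ℕ} (g : Fin E → α) (σ : Equiv.Perm (Fin E)) :
    tupleMs (g ∘ σ) = tupleMs g := by
  classical
  ext a
  rw [count_tupleMs, count_tupleMs]
  exact Fintype.card_congr (σ.subtypeEquiv (fun x => by simp))

theorem tupleMs_map {α β : Type*} {E : ℕ} (g : Fin E → α) (u : α → β) :
    (tupleMs g).map u = tupleMs (u ∘ g) := by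
  rw [tupleMs, tupleMs, Multiset.map_map]

theorem exists_perm_of_tupleMs {α : Type*} {E : ℕ} {f h : Fin E → α}
    (H : tupleMs f = tupleMs h) : ∃ σ : Equiv.Perm (Fin E), f ∘ σ = h := by
  classical
  have key : ∀ c, Nonempty ({a // h a = c} ≃ {a // f a = c}) := fun c => by
    
    have h1 := count_tupleMs h c
    rw [← H, count_tupleMs f c] at h1
    exact Fintype.card_eq.1 (by convert h1.symm)
  refine ⟨Equiv.ofFiberEquiv (fun c => (key c).some), ?_⟩
  funext a
  exact Equiv.ofFiberEquiv_map _ a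

theorem exists_tuple {α : Type*} {E : ℕ} (M : Multiset α) (hM : M.card = E) :
    ∃ g : Fin E → α, tupleMs g = M := by
  subst hM
  induction M using Quotient.inductionOn with
  | h l => exact ⟨l.get, by
      have h1 := Fin.univ_val_map l.get
      rw [List.ofFn_get] at h1
      exact h1⟩

/-- Product of the factorials of the multiplicities. -/
noncomputable def msFact {α : Type*} [DecidableEq α] (M : Multiset α) : ℕ :=
  ∏ a ∈ M.toFinset, (M.count a).factorial

theorem card_perm_eq {α : Type*} [DecidableEq α] {E : ℕ} (f h : Fin E → α) :
    (Finset.univ.filter fun σ : Equiv.Perm (Fin E) => f ∘ σ = h).card =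
      if tupleMs f = tupleMs h then msFact (tupleMs f) else 0 := by
  split_ifs with H
  · obtain ⟨π, hπ⟩ := exists_perm_of_tupleMs H
    have h1 := DomMulAct.stabilizer_card' f
    have h2 : (Finset.univ.image f) = (tupleMs f).toFinset := by
      ext a; simp [tupleMs]
    rw [h2] at h1
    simp only [← count_tupleMs] at h1
    rw [msFact, ← h1, ← Fintype.card_subtype]
    refine Fintype.card_congr ((Equiv.mulRight π⁻¹).subtypeEquiv fun σ => ?_)
    subst hπ
    constructor
    · intro hs
      funext x
      have := congrFun hs (π⁻¹ x)
      simpa using this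
    · intro hs
      funext x
      have := congrFun hs (π x)
      simpa using this
  · rw [Finset.card_eq_zero, Finset.filter_eq_empty_iff]
    intro σ _ hs
    exact H (by rw [← hs, tupleMs_comp])

theorem finite_supp_count {α β : Type*} [DecidableEq β] (M : Multiset β) (u : α → β)
    (hu : Function.Injective u) : (Function.support fun b => M.count (u b)).Finite := by
  refine Set.Finite.subset ((M.toFinset.finite_toSet).preimage hu.injOn) ?_
  intro b hb
  simpa using hb

/-- Margins of a multiset of pairs, in terms of an abstract pairing map. -/
theorem count_map_margin (M : Multiset (ℕ × ℕ)) (v : ℕ × ℕ → ℕ) (w : ℕ × ℕ → ℕ) (u : ℕ → ℕ × ℕ)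
    (a : ℕ) (hu : Function.Injective u) (h : ∀ p b, u b = p ↔ v p = a ∧ w p = b) :
    ∑ᶠ b : ℕ, M.count (u b) = (M.map v).count a := by
  induction M using Multiset.induction_on with
  | empty => simp
  | cons p M ih =>
    simp only [Multiset.count_cons, Multiset.map_cons]
    rw [finsum_add_distrib (finite_supp_count M u hu), ih]
    · congr 1
      rw [finsum_eq_single _ (w p)]
      · simp [h, eq_comm]
      · intro b hb
        rw [if_neg]
        rw [h]
        exact fun hh => hb hh.2.symm
    · refine Set.Finite.subset (Set.finite_singleton (w p)) ?_
      intro b hb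
      by_contra hn
      apply hb
      show (if u b = p then 1 else 0) = 0
      rw [if_neg]
      rw [h]
      exact fun hh => hn hh.2.symm

theorem count_map_fst (M : Multiset (ℕ × ℕ)) (a : ℕ) :
    ∑ᶠ b : ℕ, M.count (a, b) = (M.map Prod.fst).count a :=
  count_map_margin M Prod.fst Prod.snd (fun b => (a, b)) a
    (fun x y hxy => by simpa using hxy)
    (fun p b => by rw [Prod.ext_iff]; simp [eq_comm])

theorem count_map_snd (M : Multiset (ℕ × ℕ)) (a : ℕ) :
    ∑ᶠ b : ℕ, M.count (b, a) = (M.map Prod.snd).count a :=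
  count_map_margin M Prod.snd Prod.fst (fun b => (b, a)) a
    (fun x y hxy => by simpa using hxy)
    (fun p b => by rw [Prod.ext_iff]; simp [eq_comm, and_comm])

theorem finprod_fact {α : Type*} [DecidableEq α] (M : Multiset α) :
    ∏ᶠ a, ((M.count a).factorial : ℝ) = msFact M := by
  rw [finprod_eq_prod_of_mulSupport_subset (s := M.toFinset)]
  · simp [msFact]
  · intro a ha
    by_contra hn
    apply ha
    have : a ∉ M := by simpa using hn
    simp [Multiset.count_eq_zero_of_notMem this]

theorem finprod_weight {α : Type*} [DecidableEq α] (M : Multiset α) (Q : α → ℝ) :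
    ∏ᶠ a, (Q a ^ M.count a / ((M.count a).factorial : ℝ)) = (M.map Q).prod / msFact M := by
  rw [finprod_eq_prod_of_mulSupport_subset (s := M.toFinset)]
  · rw [Finset.prod_div_distrib, Finset.prod_multiset_map_count]
    simp [msFact]
  · intro a ha
    by_contra hn
    apply ha
    have : a ∉ M := by simpa using hn
    simp [Multiset.count_eq_zero_of_notMem this]

theorem msFact_pos {α : Type*} [DecidableEq α] (M : Multiset α) : 0 < msFact M :=
  Finset.prod_pos fun _ _ => Nat.factorial_pos _

/-- The label pair tuple of a wiring. -/
def wire {E : ℕ} (k j : Fin E → ℕ) (x : Equiv.Perm (Fin E) × Equiv.Perm (Fin E)) :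
    Fin E → ℕ × ℕ := fun ℓ => (k (x.1 ℓ), j (x.2 ℓ))

theorem wire_fst {E : ℕ} (k j : Fin E → ℕ) (x) :
    (tupleMs (wire k j x)).map Prod.fst = tupleMs k := by
  rw [tupleMs_map, ← tupleMs_comp k x.1]; rfl

theorem wire_snd {E : ℕ} (k j : Fin E → ℕ) (x) :
    (tupleMs (wire k j x)).map Prod.snd = tupleMs j := by
  rw [tupleMs_map, ← tupleMs_comp j x.2]; rfl

theorem exists_wire {E : ℕ} (k j : Fin E → ℕ) (M : Multiset (ℕ × ℕ))
    (h1 : M.map Prod.fst = tupleMs k) (h2 : M.map Prod.snd = tupleMs j) :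
    ∃ x, tupleMs (wire k j x) = M := by
  obtain ⟨g, rfl⟩ := exists_tuple (E := E) M (by
    rw [← Multiset.card_map Prod.fst, h1]; simp [tupleMs])
  rw [tupleMs_map] at h1 h2
  obtain ⟨σ, hσ⟩ := exists_perm_of_tupleMs h1.symm
  obtain ⟨τ, hτ⟩ := exists_perm_of_tupleMs h2.symm
  refine ⟨(σ, τ), ?_⟩
  congr 1
  funext ℓ
  exact Prod.ext (congrFun hσ ℓ) (congrFun hτ ℓ)

/-- Double counting of triples `(σ, τ, π)`. -/
theorem card_wire {E : ℕ} (k j : Fin E → ℕ) (x0 : Equiv.Perm (Fin E) × Equiv.Perm (Fin E)) :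
    (Finset.univ.filter fun x => tupleMs (wire k j x) = tupleMs (wire k j x0)).card *
      msFact (tupleMs (wire k j x0)) =
    E.factorial * (msFact (tupleMs j) * msFact (tupleMs k)) := by
  set g := wire k j x0 with hg
  have A : ∀ x, (∑ π : Equiv.Perm (Fin E), if g ∘ π = wire k j x then 1 else 0) =
      if tupleMs (wire k j x) = tupleMs g then msFact (tupleMs g) else 0 := by
    intro x
    rw [← Finset.card_filter, card_perm_eq]
    simp only [eq_comm]
  have B : ∀ π : Equiv.Perm (Fin E), (∑ x, if g ∘ π = wire k j x then 1 else 0) =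
      msFact (tupleMs j) * msFact (tupleMs k) := by
    intro π
    rw [← Finset.card_filter]
    have h1 := card_perm_eq k (Prod.fst ∘ g ∘ π)
    have h2 := card_perm_eq j (Prod.snd ∘ g ∘ π)
    rw [if_pos (by rw [← Function.comp_assoc, tupleMs_comp, ← tupleMs_map, hg, wire_fst])] at h1
    rw [if_pos (by rw [← Function.comp_assoc, tupleMs_comp, ← tupleMs_map, hg, wire_snd])] at h2
    rw [← h1, ← h2, mul_comm, ← Finset.card_product]
    congr 1
    ext x
    simp only [Finset.mem_filter, Finset.mem_univ, true_and, Finset.mem_product, funext_iff,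
      Function.comp_apply, wire, Prod.ext_iff, forall_and, eq_comm]
  have C := Finset.sum_comm (s := Finset.univ) (t := Finset.univ)
    (f := fun (x : Equiv.Perm (Fin E) × Equiv.Perm (Fin E)) (π : Equiv.Perm (Fin E)) =>
      if g ∘ π = wire k j x then 1 else 0)
  simp only [A, B] at C
  rw [← Finset.sum_filter] at C
  simpa [Fintype.card_perm] using C

/-- For `E ≥ 1`, degree label functions `k, j : Fin E → ℕ` and a nonnegative
weight `Q : ℕ × ℕ → ℝ`, the double permutation sum
`∑_{σ,τ} ∏_ℓ Q (k (σ ℓ), j (τ ℓ))` equals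
`E! · ∑_e (∏_{(k',j')} Q(k',j')^{e(k',j')}/e(k',j')!) · (∏_{j'} e⁻_{j'}!) · (∏_{k'} e⁺_{k'}!)`,
the sum running over finitely supported matrices `e` with row margins `e⁺` and column
margins `e⁻`. -/
theorem stmt0 (E : ℕ) (hE : 1 ≤ E) (k j : Fin E → ℕ) (Q : ℕ × ℕ → ℝ)
    (hQ : ∀ p, 0 ≤ Q p) :
    (∑ σ : Equiv.Perm (Fin E), ∑ τ : Equiv.Perm (Fin E),
        ∏ ℓ : Fin E, Q (k (σ ℓ), j (τ ℓ))) =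
      (Nat.factorial E : ℝ) *
        ∑ᶠ e : {e : ℕ × ℕ →₀ ℕ //
            (∀ k' : ℕ, (∑ᶠ j' : ℕ, e (k', j')) = stubCount E k k') ∧
            (∀ j' : ℕ, (∑ᶠ k' : ℕ, e (k', j')) = stubCount E j j')},
          (∏ᶠ p : ℕ × ℕ, (Q p ^ (e.1 p) / ((e.1 p).factorial : ℝ))) *
            (∏ᶠ j' : ℕ, ((stubCount E j j').factorial : ℝ)) *
            (∏ᶠ k' : ℕ, ((stubCount E k k').factorial : ℝ)) := by
  classical
  have hset : {e : ℕ × ℕ →₀ ℕ |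
            (∀ k' : ℕ, (∑ᶠ j' : ℕ, e (k', j')) = stubCount E k k') ∧
            (∀ j' : ℕ, (∑ᶠ k' : ℕ, e (k', j')) = stubCount E j j')} =
      ((Finset.univ.image fun x => Multiset.toFinsupp (tupleMs (wire k j x)) :
        Finset (ℕ × ℕ →₀ ℕ)) : Set (ℕ × ℕ →₀ ℕ)) := by
    ext e
    obtain ⟨M, rfl⟩ := Multiset.toFinsupp.surjective e
    simp only [Set.mem_ofPred_eq, Multiset.toFinsupp_apply, count_map_fst, count_map_snd,
      stubCount_eq, ← Multiset.ext, Finset.coe_image, Finset.coe_univ, Set.image_univ,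
      Set.mem_range, EmbeddingLike.apply_eq_iff_eq]
    constructor
    · rintro ⟨h1, h2⟩
      exact exists_wire k j M h1 h2
    · rintro ⟨x, rfl⟩
      exact ⟨wire_fst k j x, wire_snd k j x⟩
  have hsum := finsum_set_coe_eq_finsum_mem (f := fun e : ℕ × ℕ →₀ ℕ =>
    (∏ᶠ p : ℕ × ℕ, (Q p ^ (e p) / ((e p).factorial : ℝ))) *
            (∏ᶠ j' : ℕ, ((stubCount E j j').factorial : ℝ)) *
            (∏ᶠ k' : ℕ, ((stubCount E k k').factorial : ℝ)))
    {e : ℕ × ℕ →₀ ℕ |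
            (∀ k' : ℕ, (∑ᶠ j' : ℕ, e (k', j')) = stubCount E k k') ∧
            (∀ j' : ℕ, (∑ᶠ k' : ℕ, e (k', j')) = stubCount E j j')}
  refine Eq.trans ?_ (congrArg (fun t => (Nat.factorial E : ℝ) * t) hsum.symm)
  rw [hset, finsum_mem_coe_finset]
  simp only [stubCount_eq, finprod_fact]
  rw [← Fintype.sum_prod_type' (f := fun σ τ : Equiv.Perm (Fin E) =>
    ∏ ℓ : Fin E, Q (k (σ ℓ), j (τ ℓ)))]
  rw [← Finset.sum_fiberwise_of_maps_to (s := Finset.univ)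
    (t := Finset.univ.image fun x => Multiset.toFinsupp (tupleMs (wire k j x)))
    (g := fun x => Multiset.toFinsupp (tupleMs (wire k j x)))
    (fun x hx => Finset.mem_image_of_mem _ hx), Finset.mul_sum]
  refine Finset.sum_congr rfl fun e he => ?_
  obtain ⟨x0, -, rfl⟩ := Finset.mem_image.1 he
  simp only [Multiset.toFinsupp_apply, finprod_weight, EmbeddingLike.apply_eq_iff_eq]
  have hw : ∀ x, ∏ ℓ : Fin E, Q (k (x.1 ℓ), j (x.2 ℓ)) = ((tupleMs (wire k j x)).map Q).prod := by
    intro x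
    rw [tupleMs_map]; rfl
  have hc := card_wire k j x0
  have hp : (msFact (tupleMs (wire k j x0)) : ℝ) ≠ 0 :=
    Nat.cast_ne_zero.2 (msFact_pos _).ne'
  rw [Finset.sum_congr rfl (g := fun _ => ((tupleMs (wire k j x0)).map Q).prod)
    (fun x hx => by rw [hw, (Finset.mem_filter.1 hx).2]), Finset.sum_const, nsmul_eq_mul]
  have hc' : ((Finset.univ.filter fun x => tupleMs (wire k j x) =
      tupleMs (wire k j x0)).card : ℝ) * msFact (tupleMs (wire k j x0)) =
    E.factorial * (msFact (tupleMs j) * msFact (tupleMs k)) := by exact_mod_cast hc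
  field_simp
  linear_combination ((tupleMs (wire k j x0)).map Q).prod * hc'
end

section
/- Let E ≥ 1 and k, j : Fin E → ℕ be degree label functions with stub counts e⁺_{k'} = #{ℓ : k(ℓ) = k'} and e⁻_{j'} = #{ℓ : j(ℓ) = j'}. Let e : ℕ × ℕ → ℕ be a finitely supported matrix satisfying ∑_{j'} e(k',j') = e⁺_{k'} for every k' and ∑_{k'} e(k',j') = e⁻_{j'} for every j'. Then the number of pairs of permutations (σ,τ) of Fin E whose edge-type counts satisfy e_{k'j'}(σ,τ) = e(k',j') for all (k',j') equals E! · ( ∏_{j'} e⁻_{j'}! ) · ( ∏_{k'} e⁺_{k'}! ) / ∏_{(k',j')} e(k',j')!. -/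
open scoped BigOperators Classical

/-- The number of edges of type `(k', j')` in the wiring `(σ, τ)`. -/
def edgeTypeCount (E : ℕ) (k j : Fin E → ℕ) (σ τ : Equiv.Perm (Fin E)) (k' j' : ℕ) : ℕ :=
  (Finset.univ.filter fun ℓ => k (σ ℓ) = k' ∧ j (τ ℓ) = j').card

/-- Functions with the same fibre cardinalities differ by a permutation. -/
lemma exists_perm_comp {α ι : Type*} [Fintype α] [DecidableEq α] [DecidableEq ι] (f g : α → ι)
    (h : ∀ i, (Finset.univ.filter fun a => f a = i).card =
      (Finset.univ.filter fun a => g a = i).card) :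
    ∃ ρ : Equiv.Perm α, f ∘ ρ = g := by
  have h2 : ∀ i, Nonempty ({a // g a = i} ≃ {a // f a = i}) := fun i => by
    rw [← Fintype.card_eq, Fintype.card_subtype, Fintype.card_subtype, h i]
  let φ := fun i => (h2 i).some
  refine ⟨((Equiv.sigmaFiberEquiv g).symm.trans (Equiv.sigmaCongrRight φ)).trans
    (Equiv.sigmaFiberEquiv f), ?_⟩
  funext a
  exact (φ (g a) ⟨a, rfl⟩).2

/-- The number of permutations carrying `f` to itself. -/
lemma card_stab {α ι : Type*} [Fintype α] [DecidableEq α] [DecidableEq ι] (f : α → ι) :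
    (Finset.univ.filter fun σ : Equiv.Perm α => f ∘ σ = f).card =
      ∏ᶠ i, ((Finset.univ.filter fun a => f a = i).card).factorial := by
  have h := DomMulAct.stabilizer_card' f
  rw [Fintype.card_subtype] at h
  rw [finprod_eq_prod_of_mulSupport_subset (s := Finset.univ.image f)]
  · convert h using 3
    rw [Fintype.card_subtype]
  · intro i hi
    by_contra hc
    apply hi
    have : (Finset.univ.filter fun a => f a = i) = ∅ := by
      ext a
      simp at hc ⊢
      exact hc a
    simp [this]

/-- The number of permutations carrying `f` to `g`. -/
lemma card_transporter {α ι : Type*} [Fintype α] [DecidableEq α] [DecidableEq ι] (f g : α → ι)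
    (h : ∀ i, (Finset.univ.filter fun a => f a = i).card =
      (Finset.univ.filter fun a => g a = i).card) :
    (Finset.univ.filter fun σ : Equiv.Perm α => f ∘ σ = g).card =
      ∏ᶠ i, ((Finset.univ.filter fun a => f a = i).card).factorial := by
  obtain ⟨ρ, rfl⟩ := exists_perm_comp f g h
  rw [← card_stab]
  refine Finset.card_bij' (fun σ _ => σ * ρ⁻¹) (fun σ _ => σ * ρ) ?_ ?_ ?_ ?_
  · intro σ hσ
    simp only [Finset.mem_filter, Finset.mem_univ, true_and] at hσ ⊢
    funext a
    have := congrFun hσ (ρ⁻¹ a)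
    simpa using this
  · intro σ hσ
    simp only [Finset.mem_filter, Finset.mem_univ, true_and] at hσ ⊢
    funext a
    exact congrFun hσ (ρ a)
  · intros; simp
  · intros; simp

/-- Composing with a permutation keeps the fibre cardinalities. -/
lemma card_fiber_comp {α ι : Type*} [Fintype α] [DecidableEq α] [DecidableEq ι] (f : α → ι) (ρ : Equiv.Perm α) (i : ι) :
    (Finset.univ.filter fun a => f (ρ a) = i).card =
      (Finset.univ.filter fun a => f a = i).card := by
  refine Finset.card_bij' (fun a _ => ρ a) (fun a _ => ρ.symm a) ?_ ?_ ?_ ?_ <;> simp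

/-- A function with prescribed fibre cardinalities. -/
lemma exists_fun {ι : Type*} [DecidableEq ι] (E : ℕ) (e : ι →₀ ℕ) (h : ∑ p ∈ e.support, e p = E) :
    ∃ f : Fin E → ι, ∀ p, (Finset.univ.filter fun a => f a = p).card = e p := by
  have hc : Fintype.card (Σ p : e.support, Fin (e p)) = E := by
    rw [Fintype.card_sigma, ← h]
    simp only [Fintype.card_fin]
    exact Finset.sum_coe_sort e.support e
  let φ := Fintype.equivFinOfCardEq hc
  refine ⟨fun a => ((φ.symm a).1 : ι), fun p => ?_⟩
  have h1 : (Finset.univ.filter fun a => ((φ.symm a).1 : ι) = p).card =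
      (Finset.univ.filter fun x : (Σ p : e.support, Fin (e p)) => (x.1 : ι) = p).card := by
    refine Finset.card_bij' (fun a _ => φ.symm a) (fun a _ => φ a) ?_ ?_ ?_ ?_ <;> simp
  rw [h1]
  by_cases hp : p ∈ e.support
  · rw [← Fintype.card_fin (e p), ← Finset.card_univ]
    symm
    refine Finset.card_bij (fun a _ => ⟨⟨p, hp⟩, a⟩) ?_ ?_ ?_
    · simp
    · intro a _ b _ hab
      simpa using hab
    · rintro ⟨⟨q, hq⟩, x⟩ hx
      simp only [Finset.mem_filter, Finset.mem_univ, true_and] at hx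
      subst hx
      exact ⟨x, Finset.mem_univ _, rfl⟩
  · rw [Finsupp.notMem_support_iff.1 hp, Finset.card_eq_zero]
    ext ⟨⟨q, hq⟩, x⟩
    simp only [Finset.mem_filter, Finset.mem_univ, true_and, Finset.notMem_empty, iff_false]
    rintro rfl
    exact hp hq

/-- The number of functions with prescribed fibre cardinalities. -/
lemma card_orbit {α ι : Type*} [Fintype α] [DecidableEq α] [DecidableEq ι] (f : α → ι) :
    (Finset.univ.image fun ρ : Equiv.Perm α => f ∘ ρ).card *
      ∏ᶠ i, ((Finset.univ.filter fun a => f a = i).card).factorial =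
      (Fintype.card α).factorial := by
  rw [← Fintype.card_perm, ← Finset.card_univ,
    Finset.card_eq_sum_card_image (fun ρ : Equiv.Perm α => f ∘ ρ), Finset.sum_const_nat]
  intro g hg
  obtain ⟨ρ, -, rfl⟩ := Finset.mem_image.1 hg
  exact card_transporter f _ fun i => (card_fiber_comp f ρ i).symm

/-- First marginal of fibre counts. -/
lemma card_fst {α : Type*} [Fintype α] [DecidableEq α] (f : α → ℕ × ℕ) (e : ℕ × ℕ → ℕ)
    (h : ∀ p, (Finset.univ.filter fun a => f a = p).card = e p) (c : ℕ) :
    (Finset.univ.filter fun a => (f a).1 = c).card = ∑ᶠ d, e (c, d) := by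
  rw [finsum_eq_sum_of_support_subset (s := Finset.univ.image fun a => (f a).2)]
  · rw [Finset.card_eq_sum_card_fiberwise (f := fun a => (f a).2)
      (t := Finset.univ.image fun a => (f a).2) (by intro a _; simp)]
    refine Finset.sum_congr rfl fun d _ => ?_
    rw [← h, Finset.filter_filter]
    simp only [Prod.ext_iff]
  · intro d hd
    rw [Function.mem_support, ← h] at hd
    obtain ⟨a, ha⟩ := Finset.card_pos.1 (Nat.pos_of_ne_zero hd)
    simp only [Finset.mem_filter, Finset.mem_univ, true_and] at ha
    simp only [Finset.coe_image, Finset.coe_univ, Set.image_univ, Set.mem_range]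
    exact ⟨a, by rw [ha]⟩

/-- Second marginal of fibre counts. -/
lemma card_snd {α : Type*} [Fintype α] [DecidableEq α] (f : α → ℕ × ℕ) (e : ℕ × ℕ → ℕ)
    (h : ∀ p, (Finset.univ.filter fun a => f a = p).card = e p) (c : ℕ) :
    (Finset.univ.filter fun a => (f a).2 = c).card = ∑ᶠ d, e (d, c) := by
  refine card_fst (fun a => (f a).swap) (fun p => e p.swap) (fun p => ?_) c
  rw [← h]
  congr 1
  ext a
  simp only [Finset.mem_filter, Finset.mem_univ, true_and]
  constructor
  · rintro rfl
    simp
  · intro h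
    simp [h]

lemma stub_support (E : ℕ) (f : Fin E → ℕ) : (Function.support (stubCount E f)).Finite := by
  refine (Finset.univ.image f).finite_toSet.subset ?_
  intro d hd
  obtain ⟨a, ha⟩ := Finset.card_pos.1 (Nat.pos_of_ne_zero hd)
  simp only [Finset.mem_filter, Finset.mem_univ, true_and] at ha
  simp [← ha]

lemma total_eq (E : ℕ) (k : Fin E → ℕ) (e : ℕ × ℕ →₀ ℕ)
    (hrow : ∀ k' : ℕ, (∑ᶠ j' : ℕ, e (k', j')) = stubCount E k k') :
    ∑ p ∈ e.support, e p = E := by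
  have h1 : ∑ p ∈ e.support, e p = ∑ᶠ p, e p := by
    rw [finsum_eq_sum_of_support_subset]
    simp
  rw [h1, finsum_curry _ e.hasFiniteSupport, finsum_congr hrow,
    finsum_eq_sum_of_support_subset (s := Finset.univ.image k)]
  · have := Finset.card_eq_sum_card_image k Finset.univ
    rw [Finset.card_univ, Fintype.card_fin] at this
    exact this.symm
  · intro d hd
    obtain ⟨a, ha⟩ := Finset.card_pos.1 (Nat.pos_of_ne_zero hd)
    simp only [Finset.mem_filter, Finset.mem_univ, true_and] at ha
    simp [← ha]

lemma cast_finprod_fact {ι : Type*} (c : ι → ℕ) (hc : (Function.support c).Finite) :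
    ((∏ᶠ i, (c i).factorial : ℕ) : ℝ) = ∏ᶠ i, ((c i).factorial : ℝ) := by
  have hs : Function.mulSupport (fun i => (c i).factorial) ⊆ hc.toFinset := by
    intro i hi
    simp only [Set.Finite.coe_toFinset, Function.mem_support]
    intro h0
    exact hi (by simp [h0])
  have hs' : Function.mulSupport (fun i => ((c i).factorial : ℝ)) ⊆ hc.toFinset := by
    intro i hi
    simp only [Set.Finite.coe_toFinset, Function.mem_support]
    intro h0
    exact hi (by simp [h0])
  rw [finprod_eq_prod_of_mulSupport_subset _ hs, finprod_eq_prod_of_mulSupport_subset _ hs']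
  push_cast
  rfl

/-- The number of wirings `(σ,τ)` whose edge-type counts agree with a given
matrix `e` with margins `(e⁻, e⁺)` equals `E! · (∏_{j'} e⁻_{j'}!) · (∏_{k'} e⁺_{k'}!) / ∏ e(k',j')!`. -/
theorem stmt2 (E : ℕ) (hE : 1 ≤ E) (k j : Fin E → ℕ) (e : ℕ × ℕ →₀ ℕ)
    (hrow : ∀ k' : ℕ, (∑ᶠ j' : ℕ, e (k', j')) = stubCount E k k')
    (hcol : ∀ j' : ℕ, (∑ᶠ k' : ℕ, e (k', j')) = stubCount E j j') :
    ((Finset.univ.filter fun στ : Equiv.Perm (Fin E) × Equiv.Perm (Fin E) =>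
        ∀ k' j' : ℕ, edgeTypeCount E k j στ.1 στ.2 k' j' = e (k', j')).card : ℝ) =
      (Nat.factorial E : ℝ) * (∏ᶠ j' : ℕ, ((stubCount E j j').factorial : ℝ)) *
          (∏ᶠ k' : ℕ, ((stubCount E k k').factorial : ℝ)) /
        ∏ᶠ p : ℕ × ℕ, ((e p).factorial : ℝ) := by
  obtain ⟨f, hf⟩ := exists_fun E e (total_eq E k e hrow)
  have horb := card_orbit f
  have hcount : (Finset.univ.filter fun στ : Equiv.Perm (Fin E) × Equiv.Perm (Fin E) =>
        ∀ k' j' : ℕ, edgeTypeCount E k j στ.1 στ.2 k' j' = e (k', j')).card =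
      (Finset.univ.image fun ρ : Equiv.Perm (Fin E) => f ∘ ρ).card *
        ((∏ᶠ k' : ℕ, (stubCount E k k').factorial) *
          (∏ᶠ j' : ℕ, (stubCount E j j').factorial)) := by
    rw [Finset.card_eq_sum_card_fiberwise
      (f := fun στ : Equiv.Perm (Fin E) × Equiv.Perm (Fin E) =>
        fun ℓ => (k (στ.1 ℓ), j (στ.2 ℓ)))
      (t := Finset.univ.image fun ρ : Equiv.Perm (Fin E) => f ∘ ρ)]
    · refine Finset.sum_const_nat fun g hg => ?_
      obtain ⟨ρ, -, rfl⟩ := Finset.mem_image.1 hg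
      have hg : ∀ p, (Finset.univ.filter fun a => (f ∘ ρ) a = p).card = e p := fun p => by
        rw [← hf p]
        exact card_fiber_comp f ρ p
      generalize f ∘ ρ = g at hg
      have hA := card_transporter k (fun a => (g a).1) (fun c => by
        rw [card_fst g e hg c, hrow]; rfl)
      have hB := card_transporter j (fun a => (g a).2) (fun c => by
        rw [card_snd g e hg c, hcol]; rfl)
      change _ = (∏ᶠ k' : ℕ, (stubCount E k k').factorial) at hA
      change _ = (∏ᶠ k' : ℕ, (stubCount E j k').factorial) at hB
      rw [← hA, ← hB, ← Finset.card_product]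
      congr 1
      ext ⟨σ, τ⟩
      simp only [Finset.mem_filter, Finset.mem_univ, true_and, Finset.mem_product]
      constructor
      · rintro ⟨-, h⟩
        exact ⟨by funext a; rw [← h]; rfl, by funext a; rw [← h]; rfl⟩
      · rintro ⟨h1, h2⟩
        have h3 : (fun ℓ => (k (σ ℓ), j (τ ℓ))) = g := by
          funext a
          exact Prod.ext (congrFun h1 a) (congrFun h2 a)
        refine ⟨fun k' j' => ?_, h3⟩
        rw [← hg, ← h3]
        simp only [edgeTypeCount, Prod.mk.injEq]
    · rintro ⟨σ, τ⟩ h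
      simp only [Finset.coe_filter, Finset.mem_univ, true_and, Set.mem_ofPred_eq] at h
      obtain ⟨ρ, hρ⟩ := exists_perm_comp f (fun ℓ => (k (σ ℓ), j (τ ℓ))) (by
        rintro ⟨a, b⟩
        rw [hf, ← h]
        simp only [edgeTypeCount, Prod.mk.injEq])
      rw [Finset.mem_coe, Finset.mem_image]
      exact ⟨ρ, Finset.mem_univ _, hρ⟩
  simp only [hf, Fintype.card_fin] at horb
  have hne : (∏ᶠ p : ℕ × ℕ, ((e p).factorial : ℝ)) ≠ 0 := by
    rw [← cast_finprod_fact _ e.hasFiniteSupport]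
    intro h0
    rw [Nat.cast_eq_zero.1 h0] at horb
    exact Nat.factorial_ne_zero E (by rw [← horb, mul_zero])
  rw [eq_div_iff hne, hcount, ← horb]
  rw [Nat.cast_mul, Nat.cast_mul, Nat.cast_mul]
  rw [cast_finprod_fact _ e.hasFiniteSupport, cast_finprod_fact _ (stub_support E k),
    cast_finprod_fact _ (stub_support E j)]
  ring
end

section
/- Let E ≥ 1, k, j : Fin E → ℕ, and Q : ℕ × ℕ → ℝ nonnegative with C > 0. Fix M ≤ E and a target type sequence (κ_i, ι_i)_{i ∈ [M]}. Define margin sequences m⁺(0)_{k'} = e⁺_{k'}, m⁻(0)_{j'} = e⁻_{j'}, and m⁺(i) = m⁺(i−1) − 1_{κ_i}, m⁻(i) = m⁻(i−1) − 1_{ι_i}; assume all these stay nonnegative and that for each i ∈ [M] the margins (m⁻(i−1), m⁺(i−1)) admit a stub system whose ACG wiring measure is defined (positive normalization). Let Ē(k',j'; m⁻, m⁺) denote the expectation of e_{k'j'} under the ACG wiring measure of any stub system with margins (m⁻, m⁺) (this depends only on the margins). Then ℙ[ for all i ∈ [M], k(σ(i)) = κ_i and j(τ(i)) = ι_i ]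 = ((E−M)! / E!) · ∏_{i ∈ [M]} Ē(κ_i, ι_i; m⁻(i−1), m⁺(i−1)). -/
open scoped BigOperators Classical

/-- The weight of a wiring `(σ, τ)`. -/
noncomputable def wiringWeight (E : ℕ) (k j : Fin E → ℕ) (Q : ℕ × ℕ → ℝ)
    (σ τ : Equiv.Perm (Fin E)) : ℝ :=
  ∏ ℓ : Fin E, Q (k (σ ℓ), j (τ ℓ))

/-- The ACG normalization constant `C = ∑_{σ,τ} w(σ,τ)`. -/
noncomputable def Cnorm (E : ℕ) (k j : Fin E → ℕ) (Q : ℕ × ℕ → ℝ) : ℝ :=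
  ∑ σ : Equiv.Perm (Fin E), ∑ τ : Equiv.Perm (Fin E), wiringWeight E k j Q σ τ

/-- Expectation of the edge-type count `e_{k₀j₀}` under the ACG wiring measure. -/
noncomputable def expectEdge (E : ℕ) (k j : Fin E → ℕ) (Q : ℕ × ℕ → ℝ) (k₀ j₀ : ℕ) : ℝ :=
  (∑ σ : Equiv.Perm (Fin E), ∑ τ : Equiv.Perm (Fin E),
      (edgeTypeCount E k j σ τ k₀ j₀ : ℝ) * wiringWeight E k j Q σ τ) / Cnorm E k j Q

/-- The number of indices `i' < m` whose target label equals `d`. -/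
def usedCount (M : ℕ) (κ : Fin M → ℕ) (m : ℕ) (d : ℕ) : ℕ :=
  (Finset.univ.filter fun i : Fin M => (i : ℕ) < m ∧ κ i = d).card

theorem exists_perm_of_count {E : ℕ} (f g : Fin E → ℕ)
    (h : ∀ d, stubCount E f d = stubCount E g d) : ∃ π : Equiv.Perm (Fin E), ∀ x, g (π x) = f x := by
  have e : ∀ c, Nonempty ({ a // f a = c } ≃ { b // g b = c }) := by
    intro c
    have := h c
    unfold stubCount at this
    refine ⟨Fintype.equivOfCardEq ?_⟩
    rw [Fintype.card_subtype, Fintype.card_subtype]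
    convert this
  replace e := fun c => Classical.choice (e c)
  exact ⟨Equiv.ofFiberEquiv e, fun x => Equiv.ofFiberEquiv_map e x⟩

theorem sum_relabel {E : ℕ} {k j k' j' : Fin E → ℕ}
    (hk : ∀ d, stubCount E k d = stubCount E k' d)
    (hj : ∀ d, stubCount E j d = stubCount E j' d)
    (F : (Fin E → ℕ) → (Fin E → ℕ) → ℝ) :
    ∑ σ : Equiv.Perm (Fin E), ∑ τ : Equiv.Perm (Fin E), F (fun x => k (σ x)) (fun x => j (τ x)) =
    ∑ σ : Equiv.Perm (Fin E), ∑ τ : Equiv.Perm (Fin E),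
      F (fun x => k' (σ x)) (fun x => j' (τ x)) := by
  obtain ⟨π, hπ⟩ := exists_perm_of_count k k' hk
  obtain ⟨ρ, hρ⟩ := exists_perm_of_count j j' hj
  symm
  rw [← Equiv.sum_comp (Equiv.mulLeft π)]
  refine Finset.sum_congr rfl fun σ _ => ?_
  rw [← Equiv.sum_comp (Equiv.mulLeft ρ)]
  refine Finset.sum_congr rfl fun τ _ => ?_
  simp [hπ, hρ]

theorem Cnorm_relabel {E : ℕ} {k j k' j' : Fin E → ℕ} (Q : ℕ × ℕ → ℝ)
    (hk : ∀ d, stubCount E k d = stubCount E k' d)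
    (hj : ∀ d, stubCount E j d = stubCount E j' d) :
    Cnorm E k j Q = Cnorm E k' j' Q :=
  sum_relabel hk hj (fun f g => ∏ ℓ, Q (f ℓ, g ℓ))

theorem expectEdge_relabel {E : ℕ} {k j k' j' : Fin E → ℕ} (Q : ℕ × ℕ → ℝ) (a b : ℕ)
    (hk : ∀ d, stubCount E k d = stubCount E k' d)
    (hj : ∀ d, stubCount E j d = stubCount E j' d) :
    expectEdge E k j Q a b = expectEdge E k' j' Q a b := by
  unfold expectEdge
  rw [Cnorm_relabel Q hk hj]
  congr 1
  exact sum_relabel hk hj (fun f g =>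
    (((Finset.univ.filter fun ℓ => f ℓ = a ∧ g ℓ = b).card : ℕ) : ℝ) * ∏ ℓ, Q (f ℓ, g ℓ))

/-- Unnormalized probability of the event. -/
noncomputable def evW (E : ℕ) (k j : Fin E → ℕ) (Q : ℕ × ℕ → ℝ)
    (M : ℕ) (hM : M ≤ E) (κ ι : Fin M → ℕ) : ℝ :=
  ∑ σ : Equiv.Perm (Fin E), ∑ τ : Equiv.Perm (Fin E),
        if (∀ i : Fin M, k (σ (Fin.castLE hM i)) = κ i ∧ j (τ (Fin.castLE hM i)) = ι i)
          then wiringWeight E k j Q σ τ else 0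

/-- Remaining labels after removing stub `p`. -/
def rem {n : ℕ} (k : Fin (n + 1) → ℕ) (p : Fin (n + 1)) : Fin n → ℕ :=
  fun x => k (Equiv.swap 0 p x.succ)

theorem stubCount_rem {n : ℕ} (k : Fin (n + 1) → ℕ) (p : Fin (n + 1)) (d : ℕ) :
    stubCount (n + 1) k d = (if k p = d then 1 else 0) + stubCount n (rem k p) d := by
  unfold stubCount rem
  simp only [Finset.card_filter]
  rw [← Equiv.sum_comp (Equiv.swap 0 p), Fin.sum_univ_succ]
  simp

theorem usedCount_succ {M : ℕ} (κ : Fin (M + 1) → ℕ) (m d : ℕ) :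
    usedCount (M + 1) κ (m + 1) d =
      (if κ 0 = d then 1 else 0) + usedCount M (fun i => κ i.succ) m d := by
  unfold usedCount
  simp only [Finset.card_filter]
  rw [Fin.sum_univ_succ]
  simp

theorem usedCount_zero {M : ℕ} (κ : Fin M → ℕ) (d : ℕ) : usedCount M κ 0 d = 0 := by
  simp [usedCount]

theorem sum_decomp {n : ℕ} (F : Equiv.Perm (Fin (n + 1)) → ℝ) :
    ∑ σ, F σ = ∑ p, ∑ e, F (Equiv.Perm.decomposeFin.symm (p, e)) := by
  rw [← Equiv.sum_comp Equiv.Perm.decomposeFin.symm, Fintype.sum_prod_type]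

theorem evW_succ {n : ℕ} (k j : Fin (n + 1) → ℕ) (Q : ℕ × ℕ → ℝ)
    (M : ℕ) (hM : M + 1 ≤ n + 1) (κ ι : Fin (M + 1) → ℕ) :
    evW (n + 1) k j Q (M + 1) hM κ ι =
      ∑ p, ∑ q, if k p = κ 0 ∧ j q = ι 0 then
        Q (κ 0, ι 0) * evW n (rem k p) (rem j q) Q M (Nat.le_of_succ_le_succ hM)
          (fun i => κ i.succ) (fun i => ι i.succ) else 0 := by
  unfold evW
  rw [sum_decomp]
  refine Finset.sum_congr rfl fun p _ => ?_
  simp_rw [sum_decomp (n := n)]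
  rw [Finset.sum_comm]
  refine Finset.sum_congr rfl fun q _ => ?_
  by_cases h : k p = κ 0 ∧ j q = ι 0
  · rw [if_pos h, Finset.mul_sum]
    refine Finset.sum_congr rfl fun σ _ => ?_
    rw [Finset.mul_sum]
    refine Finset.sum_congr rfl fun τ _ => ?_
    rw [mul_ite, mul_zero]
    refine if_congr ?_ ?_ rfl
    · rw [Fin.forall_fin_succ]
      simp [h, rem]
    · unfold wiringWeight
      rw [Fin.prod_univ_succ]
      simp [h, rem]
  · rw [if_neg h]
    refine Finset.sum_eq_zero fun σ _ => Finset.sum_eq_zero fun τ _ => if_neg ?_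
    intro h'
    exact h (by simpa using h' 0)

theorem evW_zero (E : ℕ) (k j : Fin E → ℕ) (Q : ℕ × ℕ → ℝ) (hM : 0 ≤ E) (κ ι : Fin 0 → ℕ) :
    evW E k j Q 0 hM κ ι = Cnorm E k j Q := by
  simp [evW, Cnorm]

theorem pos_symm {n : ℕ} (k j : Fin (n + 1) → ℕ) (Q : ℕ × ℕ → ℝ) (a b : ℕ) (ℓ : Fin (n + 1)) :
    (∑ σ : Equiv.Perm (Fin (n + 1)), ∑ τ : Equiv.Perm (Fin (n + 1)),
      if k (σ ℓ) = a ∧ j (τ ℓ) = b then wiringWeight (n + 1) k j Q σ τ else 0) =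
    evW (n + 1) k j Q 1 (by omega) (fun _ => a) (fun _ => b) := by
  unfold evW
  rw [← Equiv.sum_comp (Equiv.mulRight (Equiv.swap 0 ℓ))]
  refine Finset.sum_congr rfl fun σ _ => ?_
  rw [← Equiv.sum_comp (Equiv.mulRight (Equiv.swap 0 ℓ))]
  refine Finset.sum_congr rfl fun τ _ => ?_
  refine if_congr ?_ ?_ rfl
  · simp
  · unfold wiringWeight
    exact Equiv.prod_comp (Equiv.swap 0 ℓ) (fun x => Q (k (σ x), j (τ x)))

theorem expect_eq {n : ℕ} (k j : Fin (n + 1) → ℕ) (Q : ℕ × ℕ → ℝ) (a b : ℕ)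
    (hC : Cnorm (n + 1) k j Q ≠ 0) :
    Cnorm (n + 1) k j Q * expectEdge (n + 1) k j Q a b =
      (n + 1 : ℝ) * evW (n + 1) k j Q 1 (by omega) (fun _ => a) (fun _ => b) := by
  unfold expectEdge
  rw [mul_div_cancel₀ _ hC]
  have : ∑ ℓ : Fin (n + 1), evW (n + 1) k j Q 1 (by omega) (fun _ => a) (fun _ => b) =
      (n + 1 : ℝ) * evW (n + 1) k j Q 1 (by omega) (fun _ => a) (fun _ => b) := by simp
  rw [← this]
  symm
  refine (Finset.sum_congr rfl fun ℓ _ => (pos_symm k j Q a b ℓ).symm).trans ?_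
  rw [Finset.sum_comm]
  refine Finset.sum_congr rfl fun σ _ => ?_
  rw [Finset.sum_comm]
  refine Finset.sum_congr rfl fun τ _ => ?_
  unfold edgeTypeCount
  rw [← Finset.sum_filter, Finset.sum_const, nsmul_eq_mul]

theorem evW_main (Q : ℕ × ℕ → ℝ) (M : ℕ) : ∀ (E : ℕ) (k j : Fin E → ℕ)
    (hM : M ≤ E) (κ ι : Fin M → ℕ) (ε : Fin M → ℝ)
    (_ : ∀ i : Fin M, ∃ (L : ℕ) (sk sj : Fin L → ℕ), L + (i : ℕ) = E ∧
      (∀ d, stubCount L sk d = stubCount E k d - usedCount M κ i d) ∧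
      (∀ d, stubCount L sj d = stubCount E j d - usedCount M ι i d) ∧
      Cnorm L sk sj Q ≠ 0 ∧ ε i = expectEdge L sk sj Q (κ i) (ι i)),
    evW E k j Q M hM κ ι * (E.factorial : ℝ) =
      Cnorm E k j Q * ((E - M).factorial : ℝ) * ∏ i, ε i := by
  induction M with
  | zero =>
    intro E k j hM κ ι ε _
    rw [evW_zero]; simp
  | succ M ih =>
    intro E k j hM κ ι ε hs
    obtain ⟨n, rfl⟩ : ∃ n, E = n + 1 := ⟨E - 1, by omega⟩
    have hMn := Nat.le_of_succ_le_succ hM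
    -- the head factor
    obtain ⟨L, sk, sj, hL, hk, hj, hC, he⟩ := hs 0
    simp only [Fin.val_zero, add_zero] at hL
    subst hL
    simp only [Fin.val_zero, usedCount_zero, Nat.sub_zero] at hk hj
    rw [Cnorm_relabel Q hk hj] at hC
    rw [expectEdge_relabel Q _ _ hk hj] at he
    have h1 := expect_eq k j Q (κ 0) (ι 0) hC
    rw [← he] at h1
    rw [evW_succ] at h1
    rw [evW_succ, Fin.prod_univ_succ]
    have key : (∑ p, ∑ q, if k p = κ 0 ∧ j q = ι 0 then
        Q (κ 0, ι 0) * evW n (rem k p) (rem j q) Q M hMn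
          (fun i => κ i.succ) (fun i => ι i.succ) else 0) * (n.factorial : ℝ) =
        (∑ p, ∑ q, if k p = κ 0 ∧ j q = ι 0 then
          Q (κ 0, ι 0) * evW n (rem k p) (rem j q) Q 0 (Nat.zero_le n)
          (fun _ => κ 0) (fun _ => ι 0) else 0) *
          (((n - M).factorial : ℝ) * ∏ i : Fin M, ε i.succ) := by
      simp_rw [Finset.sum_mul]
      refine Finset.sum_congr rfl fun p _ => Finset.sum_congr rfl fun q _ => ?_
      by_cases h : k p = κ 0 ∧ j q = ι 0
      · rw [if_pos h, if_pos h, evW_zero, mul_assoc, ih n (rem k p) (rem j q) hMn _ _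
          (fun i => ε i.succ)]
        · ring
        · intro i
          obtain ⟨L, sk, sj, hL, hk, hj, hC, he⟩ := hs i.succ
          refine ⟨L, sk, sj, ?_, ?_, ?_, hC, he⟩
          · simp at hL; omega
          · intro d
            rw [hk d, stubCount_rem k p d, Fin.val_succ, usedCount_succ, h.1]; omega
          · intro d
            rw [hj d, stubCount_rem j q d, Fin.val_succ, usedCount_succ, h.2]; omega
      · simp [h]
    have e1 : n + 1 - (M + 1) = n - M := by omega
    rw [e1, Nat.factorial_succ]
    push_cast
    linear_combination (n + 1 : ℝ) * key - ((n - M).factorial : ℝ) * (∏ i : Fin M, ε i.succ) * h1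

/-- The probability that the first `M` edges of the wiring sequence have
prescribed types `(κ_i, ι_i)` equals `((E−M)!/E!) · ∏_i Ē(κ_i, ι_i; m⁻(i−1), m⁺(i−1))`, where
`Ē` is the expected edge-type count of (any) stub system realizing the intermediate margins
`m⁺(i)_{k'} = e⁺_{k'} − #{i' ≤ i : κ_{i'} = k'}`, `m⁻(i)_{j'} = e⁻_{j'} − #{i' ≤ i : ι_{i'} = j'}`. -/
theorem stmt3 (E : ℕ) (hE : 1 ≤ E) (k j : Fin E → ℕ) (Q : ℕ × ℕ → ℝ)
    (hQ : ∀ p, 0 ≤ Q p) (hC : 0 < Cnorm E k j Q)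
    (M : ℕ) (hM : M ≤ E) (κ ι : Fin M → ℕ)
    (hplusnn : ∀ m : ℕ, m ≤ M → ∀ k' : ℕ, usedCount M κ m k' ≤ stubCount E k k')
    (hminusnn : ∀ m : ℕ, m ≤ M → ∀ j' : ℕ, usedCount M ι m j' ≤ stubCount E j j')
    (sysk sysj : (i : Fin M) → Fin (E - (i : ℕ)) → ℕ)
    (hsysk : ∀ (i : Fin M) (k' : ℕ),
      stubCount (E - (i : ℕ)) (sysk i) k' = stubCount E k k' - usedCount M κ (i : ℕ) k')
    (hsysj : ∀ (i : Fin M) (j' : ℕ),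
      stubCount (E - (i : ℕ)) (sysj i) j' = stubCount E j j' - usedCount M ι (i : ℕ) j')
    (hsysC : ∀ i : Fin M, 0 < Cnorm (E - (i : ℕ)) (sysk i) (sysj i) Q) :
    (∑ σ : Equiv.Perm (Fin E), ∑ τ : Equiv.Perm (Fin E),
        if (∀ i : Fin M, k (σ (Fin.castLE hM i)) = κ i ∧ j (τ (Fin.castLE hM i)) = ι i)
          then wiringWeight E k j Q σ τ else 0) / Cnorm E k j Q =
      ((E - M).factorial : ℝ) / (E.factorial : ℝ) *
        ∏ i : Fin M, expectEdge (E - (i : ℕ)) (sysk i) (sysj i) Q (κ i) (ι i) := by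
  have h := evW_main Q M E k j hM κ ι
    (fun i => expectEdge (E - (i : ℕ)) (sysk i) (sysj i) Q (κ i) (ι i))
    (fun i => ⟨E - (i : ℕ), sysk i, sysj i, by have := i.2; omega, hsysk i, hsysj i,
      (hsysC i).ne', rfl⟩)
  have hf : (E.factorial : ℝ) ≠ 0 := by exact_mod_cast E.factorial_ne_zero
  have hC0 := hC.ne'
  change evW E k j Q M hM κ ι / Cnorm E k j Q = _
  rw [div_mul_eq_mul_div, div_eq_div_iff hC0 hf, h]
  ring
end

section
/- Let K ≥ 1 and Q : Fin K × Fin K → ℝ with Q(k,j) > 0 for all k,j. Let e ∈ ℝ^K × ℝ^K satisfy e⁻_j > 0 for all j, e⁺_k > 0 for all k, and ∑_j e⁻_j = ∑_k e⁺_k. Then there exists a unique double vector α ∈ ℝ^K × ℝ^K such that 𝟏̃·α = 0 (i.e. ∑_j α⁻_j = ∑_k α⁺_k) and α is a critical point of H(·; e), i.e. ∑_k Q(k,j) exp(α⁻_j + α⁺_k) = e⁻_j for every j and ∑_j Q(k,j) exp(α⁻_j + α⁺_k) = e⁺_k for every k. -/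
open scoped BigOperators

/-- The reduced potential obtained by eliminating the minus variables. -/
noncomputable def redPot {K : ℕ} (Q : Fin K × Fin K → ℝ) (e : (Fin K → ℝ) × (Fin K → ℝ))
    (b : Fin K → ℝ) : ℝ :=
  ∑ j, e.1 j * Real.log (∑ k, Q (k, j) * Real.exp (b k)) - ∑ k, e.2 k * b k

lemma redPot_S_pos {K : ℕ} (hK : 1 ≤ K) (Q : Fin K × Fin K → ℝ) (hQ : ∀ p, 0 < Q p)
    (b : Fin K → ℝ) (j : Fin K) : 0 < ∑ k, Q (k, j) * Real.exp (b k) := by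
  have : Nonempty (Fin K) := ⟨⟨0, hK⟩⟩
  exact Finset.sum_pos (fun k _ => mul_pos (hQ _) (Real.exp_pos _)) Finset.univ_nonempty

lemma redPot_shift {K : ℕ} (hK : 1 ≤ K) (Q : Fin K × Fin K → ℝ) (hQ : ∀ p, 0 < Q p)
    (e : (Fin K → ℝ) × (Fin K → ℝ)) (hbal : ∑ j : Fin K, e.1 j = ∑ k : Fin K, e.2 k)
    (b : Fin K → ℝ) (c : ℝ) : redPot Q e (fun k => b k + c) = redPot Q e b := by
  unfold redPot
  have h1 : ∀ j, Real.log (∑ k, Q (k, j) * Real.exp (b k + c))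
      = Real.log (∑ k, Q (k, j) * Real.exp (b k)) + c := by
    intro j
    have : ∑ k, Q (k, j) * Real.exp (b k + c)
        = (∑ k, Q (k, j) * Real.exp (b k)) * Real.exp c := by
      rw [Finset.sum_mul]
      exact Finset.sum_congr rfl fun k _ => by rw [Real.exp_add]; ring
    rw [this, Real.log_mul (redPot_S_pos hK Q hQ b j).ne' (Real.exp_pos c).ne', Real.log_exp]
  simp only [h1, mul_add, Finset.sum_add_distrib, ← Finset.sum_mul]
  rw [hbal]; ring

lemma redPot_cont {K : ℕ} (hK : 1 ≤ K) (Q : Fin K × Fin K → ℝ) (hQ : ∀ p, 0 < Q p)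
    (e : (Fin K → ℝ) × (Fin K → ℝ)) : Continuous (redPot Q e) := by
  unfold redPot
  refine Continuous.sub (continuous_finset_sum _ fun j _ => continuous_const.mul ?_)
    (by fun_prop)
  exact Continuous.log (by fun_prop) fun b => (redPot_S_pos hK Q hQ b j).ne'

lemma redPot_exists_min {K : ℕ} (hK : 1 ≤ K) (Q : Fin K × Fin K → ℝ) (hQ : ∀ p, 0 < Q p)
    (e : (Fin K → ℝ) × (Fin K → ℝ))
    (heminus : ∀ j, 0 < e.1 j) (heplus : ∀ k, 0 < e.2 k)
    (hbal : ∑ j : Fin K, e.1 j = ∑ k : Fin K, e.2 k) :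
    ∃ b, ∀ b', redPot Q e b ≤ redPot Q e b' := by
  have : Nonempty (Fin K) := ⟨⟨0, hK⟩⟩
  obtain ⟨p, hp⟩ := Finite.exists_min Q
  obtain ⟨k₀, hk₀⟩ := Finite.exists_min e.2
  set C := ∑ j, e.1 j * Real.log (Q p) with hC
  set M := |redPot Q e 0 - C| / e.2 k₀ with hM
  have hM0 : 0 ≤ M := div_nonneg (abs_nonneg _) (heplus _).le
  have hMe : redPot Q e 0 - C ≤ e.2 k₀ * M := by
    rw [hM, mul_div_cancel₀ _ (heplus k₀).ne']
    exact le_abs_self _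
  obtain ⟨b, hb, hmin⟩ := (isCompact_Icc (a := fun _ : Fin K => -M) (b := fun _ => (0:ℝ))).exists_isMinOn
    ⟨0, ⟨fun _ => by simpa using hM0, fun _ => le_rfl⟩⟩ (redPot_cont hK Q hQ e).continuousOn
  have h0 : redPot Q e b ≤ redPot Q e 0 :=
    hmin ⟨fun _ => by simpa using hM0, fun _ => le_rfl⟩
  refine ⟨b, fun b' => ?_⟩
  obtain ⟨m, hm⟩ := Finite.exists_max b'
  rw [← redPot_shift hK Q hQ e hbal b' (-b' m)]
  set d : Fin K → ℝ := fun k => b' k + -b' m with hd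
  have hd0 : ∀ k, d k ≤ 0 := fun k => by simp only [hd]; linarith [hm k]
  have hdm : d m = 0 := by simp [hd]
  by_cases hbox : ∀ k, -M ≤ d k
  · exact hmin ⟨hbox, hd0⟩
  push Not at hbox
  obtain ⟨k, hk⟩ := hbox
  refine h0.trans ?_
  have h1 : C ≤ ∑ j, e.1 j * Real.log (∑ k, Q (k, j) * Real.exp (d k)) := by
    refine Finset.sum_le_sum fun j _ => mul_le_mul_of_nonneg_left ?_ (heminus j).le
    refine Real.log_le_log (hQ p) ((hp (m, j)).trans ?_)
    have := Finset.single_le_sum (f := fun k => Q (k, j) * Real.exp (d k))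
      (fun k _ => (mul_pos (hQ _) (Real.exp_pos _)).le) (Finset.mem_univ m)
    simpa [hdm] using this
  have h2 : e.2 k * (-d k) ≤ ∑ k, e.2 k * (-d k) :=
    Finset.single_le_sum (f := fun k => e.2 k * (-d k))
      (fun k _ => mul_nonneg (heplus k).le (by linarith [hd0 k])) (Finset.mem_univ k)
  have h3 : e.2 k₀ * M ≤ e.2 k * (-d k) :=
    mul_le_mul (hk₀ k) (by linarith) hM0 (heplus k).le
  simp only [mul_neg, Finset.sum_neg_distrib] at h2 h3
  unfold redPot at hMe ⊢
  linarith

lemma redPot_crit {K : ℕ} (hK : 1 ≤ K) (Q : Fin K × Fin K → ℝ) (hQ : ∀ p, 0 < Q p)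
    (e : (Fin K → ℝ) × (Fin K → ℝ)) (b : Fin K → ℝ)
    (hb : ∀ b', redPot Q e b ≤ redPot Q e b') (k : Fin K) :
    ∑ j, e.1 j * (Q (k, j) * Real.exp (b k) / ∑ k, Q (k, j) * Real.exp (b k)) = e.2 k := by
  let δ : Fin K → ℝ := Pi.single k 1
  have hlin : ∀ i, HasDerivAt (fun t : ℝ => b i + t * δ i) (δ i) 0 := fun i => by
    simpa using ((hasDerivAt_id (0:ℝ)).mul_const (δ i)).const_add (b i)
  have hder : HasDerivAt (fun t : ℝ => redPot Q e (fun i => b i + t * δ i))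
      (∑ j, e.1 j * ((∑ i, Q (i, j) * (Real.exp (b i) * δ i)) /
        ∑ k, Q (k, j) * Real.exp (b k)) - ∑ i, e.2 i * δ i) 0 := by
    unfold redPot
    refine HasDerivAt.sub (HasDerivAt.fun_sum fun j _ => HasDerivAt.const_mul _ ?_)
      (HasDerivAt.fun_sum fun i _ => (hlin i).const_mul _)
    have h := HasDerivAt.fun_sum (u := Finset.univ)
      (fun i _ => ((hlin i).exp).const_mul (Q (i, j)))
    have := h.log (by simpa using (redPot_S_pos hK Q hQ b j).ne')
    simpa using this
  have hz := IsLocalMin.hasDerivAt_eq_zero (Filter.Eventually.of_forall fun t => by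
    simpa using hb _) hder
  simp only [δ, Pi.single_apply, mul_ite, mul_one, mul_zero, Finset.sum_ite_eq',
    Finset.mem_univ, if_true] at hz
  linarith

lemma stmt9_unique {K : ℕ} (hK : 1 ≤ K) (Q : Fin K × Fin K → ℝ) (hQ : ∀ p, 0 < Q p)
    (e α β : (Fin K → ℝ) × (Fin K → ℝ))
    (ha0 : ∑ j : Fin K, α.1 j = ∑ k : Fin K, α.2 k)
    (ha1 : ∀ j : Fin K, ∑ k : Fin K, Q (k, j) * Real.exp (α.1 j + α.2 k) = e.1 j)
    (ha2 : ∀ k : Fin K, ∑ j : Fin K, Q (k, j) * Real.exp (α.1 j + α.2 k) = e.2 k)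
    (hb0 : ∑ j : Fin K, β.1 j = ∑ k : Fin K, β.2 k)
    (hb1 : ∀ j : Fin K, ∑ k : Fin K, Q (k, j) * Real.exp (β.1 j + β.2 k) = e.1 j)
    (hb2 : ∀ k : Fin K, ∑ j : Fin K, Q (k, j) * Real.exp (β.1 j + β.2 k) = e.2 k) :
    β = α := by
  let D : Fin K → Fin K → ℝ := fun j k =>
    Q (k, j) * Real.exp (β.1 j + β.2 k) - Q (k, j) * Real.exp (α.1 j + α.2 k)
  let w : Fin K → Fin K → ℝ := fun j k => (β.1 j + β.2 k) - (α.1 j + α.2 k)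
  have hD1 : ∀ j, ∑ k, D j k = 0 := fun j => by
    simp only [D, Finset.sum_sub_distrib, ha1, hb1, sub_self]
  have hD2 : ∀ k, ∑ j, D j k = 0 := fun k => by
    simp only [D, Finset.sum_sub_distrib, ha2, hb2, sub_self]
  have hnn : ∀ j k, 0 ≤ D j k * w j k := by
    intro j k
    have : D j k = Q (k, j) * (Real.exp (β.1 j + β.2 k) - Real.exp (α.1 j + α.2 k)) := by
      simp only [D]; ring
    rw [this, mul_assoc]
    refine mul_nonneg (hQ _).le ?_
    rcases le_total (β.1 j + β.2 k) (α.1 j + α.2 k) with h | h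
    · exact mul_nonneg_of_nonpos_of_nonpos (sub_nonpos.2 (Real.exp_le_exp.2 h)) (sub_nonpos.2 h)
    · exact mul_nonneg (sub_nonneg.2 (Real.exp_le_exp.2 h)) (sub_nonneg.2 h)
  have hsum : ∑ j, ∑ k, D j k * w j k = 0 := by
    have h : ∀ j k, D j k * w j k
        = (β.1 j - α.1 j) * D j k + (β.2 k - α.2 k) * D j k := fun j k => by
      simp only [w]; ring
    simp only [h, Finset.sum_add_distrib]
    rw [Finset.sum_comm (f := fun j k => (β.2 k - α.2 k) * D j k)]
    simp only [← Finset.mul_sum, hD1, hD2, mul_zero, Finset.sum_const_zero, add_zero]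
  have hw : ∀ j k, β.1 j + β.2 k = α.1 j + α.2 k := by
    intro j k
    have h1 := (Finset.sum_eq_zero_iff_of_nonneg
      (fun j _ => Finset.sum_nonneg fun k _ => hnn j k)).1 hsum j (Finset.mem_univ j)
    have h2 := (Finset.sum_eq_zero_iff_of_nonneg (fun k _ => hnn j k)).1 h1 k (Finset.mem_univ k)
    rcases mul_eq_zero.1 h2 with h | h
    · have h' := mul_left_cancel₀ (hQ (k, j)).ne' (sub_eq_zero.1 h)
      exact Real.exp_injective h'
    · exact sub_eq_zero.1 h
  let z : Fin K := ⟨0, hK⟩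
  set c := β.1 z - α.1 z with hc
  have hv : ∀ k, β.2 k = α.2 k - c := fun k => by linarith [hw z k]
  have hu : ∀ j, β.1 j = α.1 j + c := fun j => by linarith [hw j z, hw z z]
  have hKpos : (0:ℝ) < K := by exact_mod_cast hK
  simp only [hv, hu, Finset.sum_add_distrib, Finset.sum_sub_distrib, Finset.sum_const,
    Finset.card_univ, Fintype.card_fin, nsmul_eq_mul] at hb0
  have hc0 : c = 0 := by
    have : (K:ℝ) * c = 0 := by linarith
    exact (mul_eq_zero.1 this).resolve_left hKpos.ne'
  refine Prod.ext (funext fun j => ?_) (funext fun k => ?_)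
  · rw [hu, hc0, add_zero]
  · rw [hv, hc0, sub_zero]

/-- For `Q > 0` and margins `e` with positive entries and equal totals, there
is a unique double vector `α` with `𝟏̃·α = 0` (i.e. `∑_j α⁻_j = ∑_k α⁺_k`) that is a critical
point of `H(·; e)`: `∑_k Q(k,j) e^{α⁻_j + α⁺_k} = e⁻_j` for all `j` and
`∑_j Q(k,j) e^{α⁻_j + α⁺_k} = e⁺_k` for all `k`. -/
theorem stmt9 (K : ℕ) (hK : 1 ≤ K) (Q : Fin K × Fin K → ℝ) (hQ : ∀ p, 0 < Q p)
    (e : (Fin K → ℝ) × (Fin K → ℝ))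
    (heminus : ∀ j, 0 < e.1 j) (heplus : ∀ k, 0 < e.2 k)
    (hbal : ∑ j : Fin K, e.1 j = ∑ k : Fin K, e.2 k) :
    ∃! α : (Fin K → ℝ) × (Fin K → ℝ),
      (∑ j : Fin K, α.1 j = ∑ k : Fin K, α.2 k) ∧
      (∀ j : Fin K, ∑ k : Fin K, Q (k, j) * Real.exp (α.1 j + α.2 k) = e.1 j) ∧
      (∀ k : Fin K, ∑ j : Fin K, Q (k, j) * Real.exp (α.1 j + α.2 k) = e.2 k) := by
  obtain ⟨b, hb⟩ := redPot_exists_min hK Q hQ e heminus heplus hbal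
  have hcrit := redPot_crit hK Q hQ e b hb
  have hS := redPot_S_pos hK Q hQ b
  have hKpos : (0:ℝ) < K := by exact_mod_cast hK
  let a : Fin K → ℝ := fun j => Real.log (e.1 j / ∑ k, Q (k, j) * Real.exp (b k))
  have hexp : ∀ j, Real.exp (a j) = e.1 j / ∑ k, Q (k, j) * Real.exp (b k) := fun j =>
    Real.exp_log (div_pos (heminus j) (hS j))
  let c : ℝ := (∑ k, b k - ∑ j, a j) / (2 * K)
  have hshift : ∀ j k, Real.exp ((a j + c) + (b k - c)) = Real.exp (a j) * Real.exp (b k) := by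
    intro j k
    rw [← Real.exp_add]; congr 1; ring
  refine existsUnique_of_exists_of_unique ⟨(fun j => a j + c, fun k => b k - c), ?_, ?_, ?_⟩
    fun α β hα hβ => stmt9_unique hK Q hQ e β α hβ.1 hβ.2.1 hβ.2.2 hα.1 hα.2.1 hα.2.2
  · simp only [Finset.sum_add_distrib, Finset.sum_sub_distrib, Finset.sum_const,
      Finset.card_univ, Fintype.card_fin, nsmul_eq_mul]
    have : (K:ℝ) * c * 2 = ∑ k, b k - ∑ j, a j := by
      simp only [c]; field_simp
    linarith
  · intro j
    simp only [hshift]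
    have : ∀ k, Q (k, j) * (Real.exp (a j) * Real.exp (b k))
        = Real.exp (a j) * (Q (k, j) * Real.exp (b k)) := fun k => by ring
    simp only [this, ← Finset.mul_sum]
    rw [hexp, div_mul_cancel₀ _ (hS j).ne']
  · intro k
    simp only [hshift]
    rw [← hcrit k]
    refine Finset.sum_congr rfl fun j _ => ?_
    rw [hexp]; ring
end

section
/- Let K ≥ 1, Q : Fin K × Fin K → ℝ nonnegative, and let m⁻, m⁺ ∈ ℕ^K be margin vectors with ∑_j m⁻_j = ∑_k m⁺_k. Then the constrained sum ∑_e ∏_{j,k} Q(k,j)^{e(k,j)} / e(k,j)!, taken over all matrices e : Fin K × Fin K → ℕ with ∑_j e(k,j) = m⁺_k for every k and ∑_k e(k,j) = m⁻_j for every j, equals (2π)^{−2K} ∫_{[0,2π]^{2K}} exp( ∑_{j,k} Q(k,j) e^{i(u⁻_j + u⁺_k)} − i ∑_j u⁻_j m⁻_j − i ∑_k u⁺_k m⁺_k ) du, where u = (u⁻, u⁺) ∈ ℝ^K × ℝ^K and the integral is of a complex-valued function. -/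
open scoped BigOperators

open MeasureTheory

lemma charInt_one (n : ℤ) : ∫ x in Set.Icc (0:ℝ) (2 * Real.pi), Complex.exp (Complex.I * n * x) =
    if n = 0 then ((2 * Real.pi : ℝ) : ℂ) else 0 := by
  have hp : (0:ℝ) ≤ 2 * Real.pi := by positivity
  rw [integral_Icc_eq_integral_Ioc, ← intervalIntegral.integral_of_le hp]
  split_ifs with h
  · subst h; simp
  · rw [integral_exp_mul_complex (by simp [h])]
    have : Complex.exp (Complex.I * n * ((2 * Real.pi : ℝ) : ℂ)) = 1 := by
      rw [Complex.exp_eq_one_iff]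
      exact ⟨n, by push_cast; ring⟩
    rw [this]; simp

lemma charInt_pi (K : ℕ) (a : Fin K → ℤ) :
    ∫ x in Set.Icc (0 : Fin K → ℝ) (fun _ => 2 * Real.pi),
      ∏ j, Complex.exp (Complex.I * a j * x j) =
    if a = 0 then (((2 * Real.pi) ^ K : ℝ) : ℂ) else 0 := by
  rw [← Set.pi_univ_Icc, volume_pi, Measure.restrict_pi_pi,
    integral_fintype_prod_eq_prod (f := fun j (x : ℝ) => Complex.exp (Complex.I * a j * x))]
  simp only [Pi.zero_apply, charInt_one]
  split_ifs with h
  · subst h; simp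
  · obtain ⟨j, hj⟩ := Function.ne_iff.mp h
    exact Finset.prod_eq_zero (Finset.mem_univ j) (if_neg hj)

lemma charInt_prod (K : ℕ) (a b : Fin K → ℤ) :
    ∫ u in (Set.Icc (0 : Fin K → ℝ) (fun _ => 2 * Real.pi) ×ˢ
            Set.Icc (0 : Fin K → ℝ) (fun _ => 2 * Real.pi)),
      (∏ j, Complex.exp (Complex.I * a j * u.1 j)) * (∏ j, Complex.exp (Complex.I * b j * u.2 j)) =
    if a = 0 ∧ b = 0 then (((2 * Real.pi) ^ (2 * K) : ℝ) : ℂ) else 0 := by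
  rw [Measure.volume_eq_prod, setIntegral_prod_mul
    (fun x : Fin K → ℝ => ∏ j, Complex.exp (Complex.I * a j * x j))
    (fun x : Fin K → ℝ => ∏ j, Complex.exp (Complex.I * b j * x j)), charInt_pi, charInt_pi]
  by_cases h : a = 0 <;> by_cases h' : b = 0 <;> simp [h, h']
  ring

/-- column margin discrepancy -/
def colD {K : ℕ} (m : Fin K → ℕ) (e : Fin K × Fin K → ℕ) : Fin K → ℤ :=
  fun j => (∑ k, (e (k, j) : ℤ)) - m j

/-- row margin discrepancy -/
def rowD {K : ℕ} (m : Fin K → ℕ) (e : Fin K × Fin K → ℕ) : Fin K → ℤ :=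
  fun k => (∑ j, (e (k, j) : ℤ)) - m k

lemma expand_term (K : ℕ) (Q : Fin K × Fin K → ℝ) (mminus mplus : Fin K → ℕ) (n : ℕ)
    (u : (Fin K → ℝ) × (Fin K → ℝ)) :
    (∑ j : Fin K, ∑ k : Fin K,
        (Q (k, j) : ℂ) * Complex.exp (Complex.I * ((u.1 j : ℝ) + (u.2 k : ℝ)))) ^ n / n.factorial *
      Complex.exp (-(Complex.I * ((∑ j : Fin K, (u.1 j : ℂ) * (mminus j : ℝ)) +
                ∑ k : Fin K, (u.2 k : ℂ) * (mplus k : ℝ)))) =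
    ∑ e ∈ Finset.piAntidiag (Finset.univ : Finset (Fin K × Fin K)) n,
      ((∏ j : Fin K, ∏ k : Fin K, (Q (k, j) ^ (e (k, j)) / ((e (k, j)).factorial : ℝ)) : ℝ) : ℂ) *
      ((∏ j, Complex.exp (Complex.I * (colD mminus e j) * u.1 j)) *
        (∏ k, Complex.exp (Complex.I * (rowD mplus e k) * u.2 k))) := by
  have h1 : (∑ j : Fin K, ∑ k : Fin K,
        (Q (k, j) : ℂ) * Complex.exp (Complex.I * ((u.1 j : ℝ) + (u.2 k : ℝ)))) =
      ∑ p : Fin K × Fin K, (Q p : ℂ) * Complex.exp (Complex.I * ((u.1 p.2 : ℝ) + (u.2 p.1 : ℝ))) := by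
    rw [Fintype.sum_prod_type_right]
  rw [h1, Finset.sum_pow_eq_sum_piAntidiag, Finset.sum_div, Finset.sum_mul]
  refine Finset.sum_congr rfl fun e he => ?_
  have hn : ∑ p, e p = n := (Finset.mem_piAntidiag.mp he).1
  have h2 : ((∏ j : Fin K, ∏ k : Fin K,
      (Q (k, j) ^ (e (k, j)) / ((e (k, j)).factorial : ℝ)) : ℝ) : ℂ) =
      ∏ p, ((Q p : ℂ) ^ (e p) / ((e p).factorial : ℂ)) := by
    rw [Fintype.prod_prod_type_right]; push_cast; rfl
  have h3 : (∏ p, ((e p).factorial : ℂ)) * (Nat.multinomial Finset.univ e : ℂ) = n.factorial := by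
    rw [← hn]; exact_mod_cast Nat.multinomial_spec Finset.univ e
  have h4 : (∏ p, ((e p).factorial : ℂ)) ≠ 0 :=
    Finset.prod_ne_zero_iff.mpr fun p _ => by exact_mod_cast Nat.factorial_ne_zero _
  have h5 : (∏ p : Fin K × Fin K,
      Complex.exp (Complex.I * ((u.1 p.2 : ℝ) + (u.2 p.1 : ℝ))) ^ e p) *
      Complex.exp (-(Complex.I * ((∑ j : Fin K, (u.1 j : ℂ) * (mminus j : ℝ)) +
                ∑ k : Fin K, (u.2 k : ℂ) * (mplus k : ℝ)))) =
      ((∏ j, Complex.exp (Complex.I * (colD mminus e j) * u.1 j)) *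
        (∏ k, Complex.exp (Complex.I * (rowD mplus e k) * u.2 k))) := by
    simp only [← Complex.exp_nat_mul, ← Complex.exp_sum, ← Complex.exp_add]
    congr 1
    have e1 : ∑ p : Fin K × Fin K, (e p : ℂ) * (Complex.I * ((u.1 p.2 : ℝ) + (u.2 p.1 : ℝ))) =
        Complex.I * (∑ j, (∑ k, (e (k, j) : ℂ)) * u.1 j) +
        Complex.I * (∑ k, (∑ j, (e (k, j) : ℂ)) * u.2 k) := by
      simp only [Finset.mul_sum, Finset.sum_mul]
      rw [← Fintype.sum_prod_type_right (f := fun p : Fin K × Fin K =>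
          Complex.I * ((e (p.1, p.2) : ℂ) * (u.1 p.2 : ℂ))),
        ← Fintype.sum_prod_type (f := fun p : Fin K × Fin K =>
          Complex.I * ((e (p.1, p.2) : ℂ) * (u.2 p.1 : ℂ))), ← Finset.sum_add_distrib]
      exact Finset.sum_congr rfl fun p _ => by ring
    rw [e1]
    simp only [colD, rowD]
    push_cast
    simp only [mul_sub, sub_mul, Finset.sum_sub_distrib, mul_add, Finset.mul_sum, Finset.sum_mul]
    simp only [mul_comm, mul_assoc]
    ring
  rw [← h5, h2, ← h3]
  simp only [mul_pow, Finset.prod_mul_distrib, Finset.prod_div_distrib]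
  have h6 : (Nat.multinomial Finset.univ e : ℂ) ≠ 0 := by
    intro h; rw [h, mul_zero] at h3
    exact Nat.factorial_ne_zero n (by exact_mod_cast h3.symm)
  field_simp

lemma hasSum_cexp_aux (z : ℂ) :
    HasSum (fun n : ℕ => z ^ n / (n.factorial : ℂ)) (Complex.exp z) := by
  rw [Complex.exp_eq_exp_ℂ]
  exact NormedSpace.expSeries_div_hasSum_exp z

lemma int_term (K : ℕ) (Q : Fin K × Fin K → ℝ) (mminus mplus : Fin K → ℕ) (n : ℕ) :
    ∫ u in (Set.Icc (0 : Fin K → ℝ) (fun _ => 2 * Real.pi) ×ˢ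
            Set.Icc (0 : Fin K → ℝ) (fun _ => 2 * Real.pi)),
    (∑ j : Fin K, ∑ k : Fin K,
        (Q (k, j) : ℂ) * Complex.exp (Complex.I * ((u.1 j : ℝ) + (u.2 k : ℝ)))) ^ n / n.factorial *
      Complex.exp (-(Complex.I * ((∑ j : Fin K, (u.1 j : ℂ) * (mminus j : ℝ)) +
                ∑ k : Fin K, (u.2 k : ℂ) * (mplus k : ℝ)))) =
    ∑ e ∈ Finset.piAntidiag (Finset.univ : Finset (Fin K × Fin K)) n,
      ((∏ j : Fin K, ∏ k : Fin K, (Q (k, j) ^ (e (k, j)) / ((e (k, j)).factorial : ℝ)) : ℝ) : ℂ) *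
      if colD mminus e = 0 ∧ rowD mplus e = 0 then (((2 * Real.pi) ^ (2 * K) : ℝ) : ℂ) else 0 := by
  simp only [expand_term]
  rw [integral_finsetSum]
  · refine Finset.sum_congr rfl fun e _ => ?_
    rw [integral_const_mul, charInt_prod]
  · intro e _
    refine ContinuousOn.integrableOn_compact (isCompact_Icc.prod isCompact_Icc)
      (Continuous.continuousOn ?_)
    fun_prop

theorem stmt10 (K : ℕ) (hK : 1 ≤ K) (Q : Fin K × Fin K → ℝ) (hQ : ∀ p, 0 ≤ Q p)
    (mminus mplus : Fin K → ℕ)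
    (hbal : ∑ j : Fin K, mminus j = ∑ k : Fin K, mplus k) :
    ((∑ᶠ e : {e : Fin K × Fin K → ℕ //
          (∀ k : Fin K, ∑ j : Fin K, e (k, j) = mplus k) ∧
          (∀ j : Fin K, ∑ k : Fin K, e (k, j) = mminus j)},
        ∏ j : Fin K, ∏ k : Fin K,
          (Q (k, j) ^ (e.1 (k, j)) / ((e.1 (k, j)).factorial : ℝ)) : ℝ) : ℂ) =
      (1 / (2 * Real.pi) ^ (2 * K) : ℝ) *
        ∫ u in (Set.Icc (0 : Fin K → ℝ) (fun _ => 2 * Real.pi) ×ˢ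
            Set.Icc (0 : Fin K → ℝ) (fun _ => 2 * Real.pi)),
          Complex.exp
            ((∑ j : Fin K, ∑ k : Fin K,
                (Q (k, j) : ℂ) * Complex.exp (Complex.I * ((u.1 j : ℝ) + (u.2 k : ℝ)))) -
              Complex.I * ((∑ j : Fin K, (u.1 j : ℝ) * (mminus j : ℝ)) +
                ∑ k : Fin K, (u.2 k : ℝ) * (mplus k : ℝ))) := by
  have key : ∀ e : Fin K × Fin K → ℕ, (colD mminus e = 0 ∧ rowD mplus e = 0) ↔
      ((∀ k : Fin K, ∑ j : Fin K, e (k, j) = mplus k) ∧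
          (∀ j : Fin K, ∑ k : Fin K, e (k, j) = mminus j)) := by
    intro e
    simp only [funext_iff, colD, rowD, Pi.zero_apply, sub_eq_zero]
    norm_cast
    exact and_comm
  have hM : ∀ e : Fin K × Fin K → ℕ, (colD mminus e = 0 ∧ rowD mplus e = 0) →
      ∑ p, e p = ∑ k, mplus k := by
    intro e he
    rw [Fintype.sum_prod_type]
    exact Finset.sum_congr rfl fun k _ => ((key e).1 he).1 k
  have hs : HasSum (fun n : ℕ => ∫ u in (Set.Icc (0 : Fin K → ℝ) (fun _ => 2 * Real.pi) ×ˢ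
            Set.Icc (0 : Fin K → ℝ) (fun _ => 2 * Real.pi)),
    (∑ j : Fin K, ∑ k : Fin K,
        (Q (k, j) : ℂ) * Complex.exp (Complex.I * ((u.1 j : ℝ) + (u.2 k : ℝ)))) ^ n / n.factorial *
      Complex.exp (-(Complex.I * ((∑ j : Fin K, (u.1 j : ℂ) * (mminus j : ℝ)) +
                ∑ k : Fin K, (u.2 k : ℂ) * (mplus k : ℝ)))))
      (∫ u in (Set.Icc (0 : Fin K → ℝ) (fun _ => 2 * Real.pi) ×ˢ
            Set.Icc (0 : Fin K → ℝ) (fun _ => 2 * Real.pi)),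
          Complex.exp
            ((∑ j : Fin K, ∑ k : Fin K,
                (Q (k, j) : ℂ) * Complex.exp (Complex.I * ((u.1 j : ℝ) + (u.2 k : ℝ)))) -
              Complex.I * ((∑ j : Fin K, (u.1 j : ℝ) * (mminus j : ℝ)) +
                ∑ k : Fin K, (u.2 k : ℝ) * (mplus k : ℝ)))) := by
    refine hasSum_integral_of_dominated_convergence
      (fun n _ => (∑ j : Fin K, ∑ k : Fin K, Q (k, j)) ^ n / n.factorial) ?_ ?_ ?_ ?_ ?_
    · intro n
      apply Continuous.aestronglyMeasurable
      fun_prop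
    · intro n
      refine Filter.Eventually.of_forall fun u => ?_
      have hu : ‖Complex.exp (-(Complex.I * ((∑ j : Fin K, (u.1 j : ℂ) * (mminus j : ℝ)) +
                ∑ k : Fin K, (u.2 k : ℂ) * (mplus k : ℝ))))‖ = 1 := by
        rw [Complex.norm_exp]
        simp
      rw [norm_mul, hu, mul_one, norm_div, norm_pow, Complex.norm_natCast]
      gcongr
      refine (norm_sum_le _ _).trans (Finset.sum_le_sum fun j _ =>
        (norm_sum_le _ _).trans (Finset.sum_le_sum fun k _ => ?_))
      rw [norm_mul, Complex.norm_exp, Complex.norm_real, Real.norm_of_nonneg (hQ _)]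
      simp
    · exact Filter.Eventually.of_forall fun u => Real.summable_pow_div_factorial _
    · refine integrableOn_const ?_
      exact (isCompact_Icc.prod isCompact_Icc).measure_lt_top.ne
    · refine Filter.Eventually.of_forall fun u => ?_
      rw [sub_eq_add_neg, Complex.exp_add]
      simp only [Complex.ofReal_sum, Complex.ofReal_mul]
      exact (hasSum_cexp_aux _).mul_right _
  have hs' := hs.tsum_eq
  rw [tsum_eq_single (∑ k, mplus k)] at hs'
  · rw [← hs', int_term]
    classical
    have hL : (∑ᶠ e : {e : Fin K × Fin K → ℕ //
          (∀ k : Fin K, ∑ j : Fin K, e (k, j) = mplus k) ∧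
          (∀ j : Fin K, ∑ k : Fin K, e (k, j) = mminus j)},
        ∏ j : Fin K, ∏ k : Fin K,
          (Q (k, j) ^ (e.1 (k, j)) / ((e.1 (k, j)).factorial : ℝ)) : ℝ) =
        ∑ e ∈ (Finset.piAntidiag (Finset.univ : Finset (Fin K × Fin K)) (∑ k, mplus k)).filter
          (fun e => colD mminus e = 0 ∧ rowD mplus e = 0),
          ∏ j : Fin K, ∏ k : Fin K, (Q (k, j) ^ (e (k, j)) / ((e (k, j)).factorial : ℝ)) := by
      rw [← finsum_mem_coe_finset, finsum_subtype_eq_finsum_cond (f := fun e : Fin K × Fin K → ℕ =>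
        ∏ j : Fin K, ∏ k : Fin K, (Q (k, j) ^ (e (k, j)) / ((e (k, j)).factorial : ℝ)))]
      refine finsum_congr fun e => finsum_congr_Prop ?_ fun _ => rfl
      rw [← key e]
      simp only [Finset.coe_filter, Set.mem_ofPred_eq, Finset.mem_piAntidiag, eq_iff_iff]
      exact ⟨fun h => ⟨⟨hM e h, by simp⟩, h⟩, fun h => h.2⟩
    rw [hL, Finset.sum_filter, Complex.ofReal_sum, Finset.mul_sum]
    refine Finset.sum_congr rfl fun e _ => ?_
    have hpi : ((Real.pi : ℝ) : ℂ) ≠ 0 := by exact_mod_cast Real.pi_ne_zero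
    split_ifs
    · push_cast
      field_simp
    · simp
  · intro n hn
    rw [int_term]
    refine Finset.sum_eq_zero fun e he => ?_
    rw [if_neg, mul_zero]
    intro h
    exact hn ((Finset.mem_piAntidiag.mp he).1.symm.trans (hM e h))
end

section
/- Let K ≥ 1 and Q : Fin K × Fin K → ℝ with Q(k,j) > 0 for all k,j, and let M = { x ∈ ℝ^K × ℝ^K : all components of x are positive and ∑_j x⁻_j = ∑_k x⁺_k }. For x ∈ M let α*(x) be the unique critical point of H(·; x) with 𝟏̃·α*(x) = 0, and let φ(x) = H(α*(x); x). Then the map x ↦ α*(x) is continuously differentiable on M, and for every x ∈ M and every direction v ∈ ℝ^K × ℝ^K with ∑_j v⁻_j = 0 and ∑_k v⁺_k = 0: (i) the directional derivative of φ at x in direction v equals −α*(x)·v; and (ii) the directional derivative of x ↦ α*(x) at x in direction v, paired with x, vanishes: (D_v α*)(x) · x = 0. Consequently, for x, x' ∈ M whose minus-margins have equal sums and whose plus-margins have equal sums, φ(x') − φ(x) = −α*(x)·(x'−x) + O(|x'−x|²) and (α*(x') − α*(x))·x = O(|x'−x|²) as x' → x. -/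
open scoped BigOperators

open Filter Asymptotics

/-- The real `H` function: `H(α; e) = ∑_{j,k} Q(k,j) exp(α⁻_j + α⁺_k) − α·e`. -/
noncomputable def Hreal (K : ℕ) (Q : Fin K × Fin K → ℝ)
    (α e : (Fin K → ℝ) × (Fin K → ℝ)) : ℝ :=
  (∑ j : Fin K, ∑ k : Fin K, Q (k, j) * Real.exp (α.1 j + α.2 k)) -
    ((∑ j : Fin K, α.1 j * e.1 j) + ∑ k : Fin K, α.2 k * e.2 k)

/-- The inner product of double vectors. -/
def dotDV (K : ℕ) (a b : (Fin K → ℝ) × (Fin K → ℝ)) : ℝ :=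
  (∑ j : Fin K, a.1 j * b.1 j) + ∑ k : Fin K, a.2 k * b.2 k

/-- The set `M` of double vectors with positive components and equal margin sums. -/
def Mset (K : ℕ) : Set ((Fin K → ℝ) × (Fin K → ℝ)) :=
  {x | (∀ j, 0 < x.1 j) ∧ (∀ k, 0 < x.2 k) ∧ ∑ j : Fin K, x.1 j = ∑ k : Fin K, x.2 k}

/-- The regularised gradient map. -/
noncomputable def Fmap15 (K : ℕ) (Q : Fin K × Fin K → ℝ)
    (α : (Fin K → ℝ) × (Fin K → ℝ)) : (Fin K → ℝ) × (Fin K → ℝ) :=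
  (fun j => ∑ k : Fin K, Q (k, j) * Real.exp (α.1 j + α.2 k)
      + (∑ i : Fin K, α.1 i - ∑ i : Fin K, α.2 i),
   fun k => ∑ j : Fin K, Q (k, j) * Real.exp (α.1 j + α.2 k)
      - (∑ i : Fin K, α.1 i - ∑ i : Fin K, α.2 i))

theorem dot_double15 {K : ℕ} (f : Fin K → Fin K → ℝ) (u v : Fin K → ℝ) :
    (∑ j, u j * ∑ k, f j k) + ∑ k, v k * ∑ j, f j k
      = ∑ j, ∑ k, f j k * (u j + v k) := by
  have h2 : ∑ k, v k * ∑ j, f j k = ∑ j, ∑ k, v k * f j k := by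
    rw [Finset.sum_comm]
    exact Finset.sum_congr rfl fun k _ => by rw [Finset.mul_sum]
  rw [h2, ← Finset.sum_add_distrib]
  refine Finset.sum_congr rfl fun j _ => ?_
  rw [Finset.mul_sum, ← Finset.sum_add_distrib]
  exact Finset.sum_congr rfl fun k _ => by ring

theorem dot_double15' {K : ℕ} (f : Fin K → Fin K → ℝ) (s : ℝ) (u v : Fin K → ℝ)
    (h1 : ∀ j, ∑ k, f j k + s = 0) (h2 : ∀ k, ∑ j, f j k - s = 0) :
    ∑ j, ∑ k, f j k * (u j + v k) + s * (∑ j, u j - ∑ k, v k) = 0 := by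
  rw [← dot_double15]
  have e1 : ∀ j, ∑ k, f j k = -s := fun j => by linarith [h1 j]
  have e2 : ∀ j, ∑ k, f k j = s := fun j => by linarith [h2 j]
  simp only [e1, e2, ← Finset.sum_mul]
  ring

theorem zero_of15 {K : ℕ} (hK : 1 ≤ K) (f : Fin K → Fin K → ℝ)
    (d : (Fin K → ℝ) × (Fin K → ℝ))
    (h1 : ∀ j, ∑ k, f j k + (∑ j, d.1 j - ∑ k, d.2 k) = 0)
    (h2 : ∀ k, ∑ j, f j k - (∑ j, d.1 j - ∑ k, d.2 k) = 0)
    (hf : ∀ j k, 0 ≤ f j k * (d.1 j + d.2 k))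
    (hf0 : ∀ j k, f j k * (d.1 j + d.2 k) = 0 → d.1 j + d.2 k = 0) : d = 0 := by
  have h := dot_double15' f _ d.1 d.2 h1 h2
  have hA : 0 ≤ ∑ j, ∑ k, f j k * (d.1 j + d.2 k) :=
    Finset.sum_nonneg fun j _ => Finset.sum_nonneg fun k _ => hf j k
  have hB := mul_self_nonneg (∑ j, d.1 j - ∑ k, d.2 k)
  have hA0 : ∑ j, ∑ k, f j k * (d.1 j + d.2 k) = 0 := by linarith
  have hB0 : (∑ j, d.1 j - ∑ k, d.2 k) = 0 := mul_self_eq_zero.mp (by linarith)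
  have hz : ∀ j k, d.1 j + d.2 k = 0 := by
    intro j k
    apply hf0
    rw [Finset.sum_eq_zero_iff_of_nonneg
      (fun j _ => Finset.sum_nonneg fun k _ => hf j k)] at hA0
    have := hA0 j (Finset.mem_univ _)
    rw [Finset.sum_eq_zero_iff_of_nonneg (fun k _ => hf j k)] at this
    exact this k (Finset.mem_univ _)
  let o : Fin K := ⟨0, hK⟩
  have e1 : ∀ j, d.1 j = d.1 o := fun j => by linarith [hz j o, hz o o]
  have e2 : ∀ j, d.2 j = - d.1 o := fun j => by linarith [hz o j]
  have hKr : (0:ℝ) < K := by exact_mod_cast hK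
  have hc : d.1 o = 0 := by
    simp only [e1, e2, Finset.sum_const, Finset.card_univ, Fintype.card_fin, nsmul_eq_mul] at hB0
    have : (K:ℝ) * d.1 o = 0 := by linarith
    rcases mul_eq_zero.mp this with h | h
    · linarith
    · exact h
  ext j
  · simp [e1 j, hc]
  · simp [e2 j, hc]

theorem Fmap15_inj {K : ℕ} (hK : 1 ≤ K) (Q : Fin K × Fin K → ℝ) (hQ : ∀ p, 0 < Q p) :
    Function.Injective (Fmap15 K Q) := by
  intro a b hab
  have hp := Prod.ext_iff.mp hab
  have h1 := fun j => congrFun hp.1 j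
  have h2 := fun j => congrFun hp.2 j
  simp only [Fmap15] at h1 h2
  rw [← sub_eq_zero]
  have key : ∀ j k, (a - b).1 j + (a - b).2 k = (a.1 j + a.2 k) - (b.1 j + b.2 k) := by
    intro j k
    simp only [Prod.fst_sub, Prod.snd_sub, Pi.sub_apply]; ring
  apply zero_of15 hK (fun j k => Q (k, j) * Real.exp (a.1 j + a.2 k)
    - Q (k, j) * Real.exp (b.1 j + b.2 k))
  · intro j
    have := h1 j
    simp only [Finset.sum_sub_distrib, Prod.fst_sub, Prod.snd_sub, Pi.sub_apply]
    linarith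
  · intro j
    have := h2 j
    simp only [Finset.sum_sub_distrib, Prod.fst_sub, Prod.snd_sub, Pi.sub_apply]
    linarith
  · intro j k
    rw [key, ← mul_sub, mul_assoc]
    refine mul_nonneg (hQ _).le ?_
    rcases le_total (a.1 j + a.2 k) (b.1 j + b.2 k) with h | h
    · exact mul_nonneg_of_nonpos_of_nonpos (sub_nonpos.2 (Real.exp_le_exp.2 h)) (sub_nonpos.2 h)
    · exact mul_nonneg (sub_nonneg.2 (Real.exp_le_exp.2 h)) (sub_nonneg.2 h)
  · intro j k h
    rw [key]
    rw [key, ← mul_sub, mul_assoc] at h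
    rcases mul_eq_zero.mp h with h | h
    · exact absurd h (hQ _).ne'
    rcases mul_eq_zero.mp h with h | h
    · rw [sub_eq_zero] at h ⊢
      exact Real.exp_injective h
    · exact h

theorem Fmap15_contDiff {K : ℕ} (Q : Fin K × Fin K → ℝ) : ContDiff ℝ 1 (Fmap15 K Q) := by
  unfold Fmap15
  fun_prop

theorem Fmap15_fderiv {K : ℕ} (Q : Fin K × Fin K → ℝ) (α w : (Fin K → ℝ) × (Fin K → ℝ)) :
    fderiv ℝ (Fmap15 K Q) α w =
    (fun j => ∑ k : Fin K, Q (k, j) * Real.exp (α.1 j + α.2 k) * (w.1 j + w.2 k)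
      + (∑ i : Fin K, w.1 i - ∑ i : Fin K, w.2 i),
     fun k => ∑ j : Fin K, Q (k, j) * Real.exp (α.1 j + α.2 k) * (w.1 j + w.2 k)
      - (∑ i : Fin K, w.1 i - ∑ i : Fin K, w.2 i)) := by
  have hd : HasFDerivAt (Fmap15 K Q) (fderiv ℝ (Fmap15 K Q) α) (α + (0:ℝ) • w) := by
    simpa using ((Fmap15_contDiff Q).differentiable (by norm_num) α).hasFDerivAt
  have hl : HasDerivAt (fun t : ℝ => α + t • w) w 0 := by
    simpa using ((hasDerivAt_id (0:ℝ)).smul_const w).const_add α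
  have h := hd.comp_hasDerivAt (0:ℝ) hl
  refine h.unique ?_
  have c1 : ∀ j, HasDerivAt (fun t : ℝ => (α + t • w).1 j) (w.1 j) 0 := fun j => by
    simpa using ((hasDerivAt_id (0:ℝ)).mul_const (w.1 j)).const_add (α.1 j)
  have c2 : ∀ j, HasDerivAt (fun t : ℝ => (α + t • w).2 j) (w.2 j) 0 := fun j => by
    simpa using ((hasDerivAt_id (0:ℝ)).mul_const (w.2 j)).const_add (α.2 j)
  have ce : ∀ j k, HasDerivAt (fun t : ℝ => Q (k, j) *
      Real.exp ((α + t • w).1 j + (α + t • w).2 k))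
      (Q (k, j) * Real.exp (α.1 j + α.2 k) * (w.1 j + w.2 k)) 0 := fun j k => by
    have := (((c1 j).fun_add (c2 k)).exp).const_mul (Q (k, j))
    simpa [mul_assoc] using this
  have cs : HasDerivAt (fun t : ℝ => ∑ i, (α + t • w).1 i - ∑ i, (α + t • w).2 i)
      (∑ i, w.1 i - ∑ i, w.2 i) 0 :=
    (HasDerivAt.fun_sum fun i _ => c1 i).fun_sub (HasDerivAt.fun_sum fun i _ => c2 i)
  refine HasDerivAt.prodMk (f₁ := fun t => (Fmap15 K Q (α + t • w)).1)
    (f₂ := fun t => (Fmap15 K Q (α + t • w)).2) ?_ ?_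
  · rw [hasDerivAt_pi]
    intro j
    exact (HasDerivAt.fun_sum fun k _ => ce j k).fun_add cs
  · rw [hasDerivAt_pi]
    intro k
    exact (HasDerivAt.fun_sum fun j _ => ce j k).fun_sub cs

theorem Fmap15_equiv {K : ℕ} (hK : 1 ≤ K) (Q : Fin K × Fin K → ℝ) (hQ : ∀ p, 0 < Q p)
    (α : (Fin K → ℝ) × (Fin K → ℝ)) :
    ∃ e : ((Fin K → ℝ) × (Fin K → ℝ)) ≃L[ℝ] ((Fin K → ℝ) × (Fin K → ℝ)),
      (e : ((Fin K → ℝ) × (Fin K → ℝ)) →L[ℝ] ((Fin K → ℝ) × (Fin K → ℝ)))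
        = fderiv ℝ (Fmap15 K Q) α := by
  have hi : Function.Injective (fderiv ℝ (Fmap15 K Q) α :
      ((Fin K → ℝ) × (Fin K → ℝ)) →ₗ[ℝ] ((Fin K → ℝ) × (Fin K → ℝ))) := by
    rw [injective_iff_map_eq_zero]
    intro w hw
    have hw' : fderiv ℝ (Fmap15 K Q) α w = 0 := hw
    rw [Fmap15_fderiv] at hw'
    have hp := Prod.ext_iff.mp hw'
    have hpos : ∀ j k, 0 < Q (k, j) * Real.exp (α.1 j + α.2 k) :=
      fun j k => mul_pos (hQ _) (Real.exp_pos _)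
    apply zero_of15 hK
      (fun j k => Q (k, j) * Real.exp (α.1 j + α.2 k) * (w.1 j + w.2 k))
    · exact fun j => congrFun hp.1 j
    · exact fun j => congrFun hp.2 j
    · intro j k
      rw [mul_assoc]
      exact mul_nonneg (hpos j k).le (mul_self_nonneg _)
    · intro j k h
      rw [mul_assoc] at h
      rcases mul_eq_zero.mp h with h | h
      · exact absurd h (hpos j k).ne'
      · exact mul_self_eq_zero.mp h
  refine ⟨(LinearEquiv.ofInjectiveEndo _ hi).toContinuousLinearEquiv, ?_⟩
  exact ContinuousLinearMap.ext fun w => rfl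


/-- The critical point map `x ↦ α*(x)` is continuously differentiable on
`M`; for directions `v` with `∑ v⁻ = 0` and `∑ v⁺ = 0` the directional derivative of
`φ(x) = H(α*(x); x)` is `−α*(x)·v` and `(D_v α*)(x)·x = 0`; consequently
`φ(x') − φ(x) = −α*(x)·(x'−x) + O(|x'−x|²)` and `(α*(x')−α*(x))·x = O(|x'−x|²)` as `x' → x`
along points of `M` with matching margin sums. -/
theorem stmt15 (K : ℕ) (hK : 1 ≤ K) (Q : Fin K × Fin K → ℝ) (hQ : ∀ p, 0 < Q p)
    (αstar : (Fin K → ℝ) × (Fin K → ℝ) → (Fin K → ℝ) × (Fin K → ℝ))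
    (hαstar : ∀ x ∈ Mset K,
      (∑ j : Fin K, (αstar x).1 j = ∑ k : Fin K, (αstar x).2 k) ∧
      (∀ j : Fin K, ∑ k : Fin K,
        Q (k, j) * Real.exp ((αstar x).1 j + (αstar x).2 k) = x.1 j) ∧
      (∀ k : Fin K, ∑ j : Fin K,
        Q (k, j) * Real.exp ((αstar x).1 j + (αstar x).2 k) = x.2 k)) :
    ∃ D : (Fin K → ℝ) × (Fin K → ℝ) →
        ((Fin K → ℝ) × (Fin K → ℝ)) →L[ℝ] ((Fin K → ℝ) × (Fin K → ℝ)),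
      ContinuousOn D (Mset K) ∧
      (∀ x ∈ Mset K, HasFDerivWithinAt αstar (D x) (Mset K) x) ∧
      (∀ x ∈ Mset K, ∀ v : (Fin K → ℝ) × (Fin K → ℝ),
        (∑ j : Fin K, v.1 j = 0) → (∑ k : Fin K, v.2 k = 0) →
        HasDerivAt (fun t : ℝ => Hreal K Q (αstar (x + t • v)) (x + t • v))
          (-(dotDV K (αstar x) v)) 0 ∧
        dotDV K (D x v) x = 0) ∧
      (∀ x ∈ Mset K,
        ((fun x' => Hreal K Q (αstar x') x' - Hreal K Q (αstar x) x +
            dotDV K (αstar x) (x' - x)) =O[nhdsWithin x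
          {x' ∈ Mset K | (∑ j : Fin K, x'.1 j = ∑ j : Fin K, x.1 j) ∧
            ∑ k : Fin K, x'.2 k = ∑ k : Fin K, x.2 k}]
          (fun x' => ‖x' - x‖ ^ 2)) ∧
        ((fun x' => dotDV K (αstar x' - αstar x) x) =O[nhdsWithin x
          {x' ∈ Mset K | (∑ j : Fin K, x'.1 j = ∑ j : Fin K, x.1 j) ∧
            ∑ k : Fin K, x'.2 k = ∑ k : Fin K, x.2 k}]
          (fun x' => ‖x' - x‖ ^ 2))) := by
  have hF : ∀ x ∈ Mset K, Fmap15 K Q (αstar x) = x := by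
    intro x hx
    obtain ⟨h0, h1, h2⟩ := hαstar x hx
    ext j
    · simp [Fmap15, h0, h1]
    · simp [Fmap15, h0, h2]
  have hder : ∀ x ∈ Mset K, HasFDerivWithinAt αstar
      (fderiv ℝ (Fmap15 K Q) (αstar x)).inverse (Mset K) x := by
    intro x hx
    obtain ⟨e, he⟩ := Fmap15_equiv hK Q hQ (αstar x)
    have hs : HasStrictFDerivAt (Fmap15 K Q)
        (e : ((Fin K → ℝ) × (Fin K → ℝ)) →L[ℝ] ((Fin K → ℝ) × (Fin K → ℝ))) (αstar x) := by
      rw [he]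
      exact (Fmap15_contDiff Q).contDiffAt.hasStrictFDerivAt (by norm_num)
    have hinv := hs.to_localInverse.hasFDerivAt
    have hr := hs.eventually_right_inverse
    rw [hF x hx] at hinv hr
    rw [← he, ContinuousLinearMap.inverse_equiv]
    refine hinv.hasFDerivWithinAt.congr_of_eventuallyEq ?_ ?_
    · filter_upwards [mem_nhdsWithin_of_mem_nhds hr, self_mem_nhdsWithin] with y hy hyM
      exact Fmap15_inj hK Q hQ (by rw [hF y hyM]; exact hy.symm)
    · exact Fmap15_inj hK Q hQ (by rw [hF x hx]; exact hr.self_of_nhds.symm)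
  have hO2 : ∀ x ∈ Mset K, (fun x' => dotDV K (αstar x' - αstar x) x) =O[nhdsWithin x
          {x' ∈ Mset K | (∑ j : Fin K, x'.1 j = ∑ j : Fin K, x.1 j) ∧
            ∑ k : Fin K, x'.2 k = ∑ k : Fin K, x.2 k}]
          (fun x' => ‖x' - x‖ ^ 2) := by
    intro x hx
    have hsub : {x' ∈ Mset K | (∑ j : Fin K, x'.1 j = ∑ j : Fin K, x.1 j) ∧
            ∑ k : Fin K, x'.2 k = ∑ k : Fin K, x.2 k} ⊆ Mset K := fun y hy => hy.1
    have hd := (hder x hx).mono hsub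
    have hlip := hd.isBigO_sub
    have hlip2 : (fun x' => ‖αstar x' - αstar x‖ ^ 2) =O[nhdsWithin x
          {x' ∈ Mset K | (∑ j : Fin K, x'.1 j = ∑ j : Fin K, x.1 j) ∧
            ∑ k : Fin K, x'.2 k = ∑ k : Fin K, x.2 k}] (fun x' => ‖x' - x‖ ^ 2) :=
      (hlip.norm_norm).pow 2
    refine IsBigO.trans ?_ hlip2
    have hc := hd.continuousWithinAt
    have hsmall := (Metric.tendsto_nhds.mp hc) (1/2) (by norm_num)
    refine IsBigO.of_bound (∑ j, x.1 j * 4) ?_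
    filter_upwards [hsmall, self_mem_nhdsWithin] with y hy hyS
    rw [dist_eq_norm] at hy
    obtain ⟨hyM, hy1, hy2⟩ := hyS
    obtain ⟨-, a1, a2⟩ := hαstar x hx
    obtain ⟨-, b1, b2⟩ := hαstar y hyM
    set d := αstar y - αstar x with hdd
    set p : Fin K → Fin K → ℝ := fun j k => Q (k, j) * Real.exp ((αstar x).1 j + (αstar x).2 k)
      with hp
    have hdot : dotDV K d x = ∑ j, ∑ k, p j k * (d.1 j + d.2 k) := by
      rw [← dot_double15]
      simp only [dotDV, hp, a1, a2]
    have hexp : ∀ j k, Q (k, j) * Real.exp ((αstar y).1 j + (αstar y).2 k)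
        = p j k * Real.exp (d.1 j + d.2 k) := by
      intro j k
      simp only [hp, mul_assoc, ← Real.exp_add, hdd, Prod.fst_sub, Prod.snd_sub, Pi.sub_apply]
      congr 2
      ring
    have hz : ∑ j, ∑ k, (p j k * Real.exp (d.1 j + d.2 k) - p j k) = 0 := by
      simp only [Finset.sum_sub_distrib, ← hexp, b1]
      simp only [hp, a1, hy1, sub_self]
    have hdot' : dotDV K d x = - ∑ j, ∑ k, p j k *
        (Real.exp (d.1 j + d.2 k) - 1 - (d.1 j + d.2 k)) := by
      have : ∑ j, ∑ k, p j k * (Real.exp (d.1 j + d.2 k) - 1 - (d.1 j + d.2 k))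
          = ∑ j, ∑ k, (p j k * Real.exp (d.1 j + d.2 k) - p j k)
            - ∑ j, ∑ k, p j k * (d.1 j + d.2 k) := by
        simp only [← Finset.sum_sub_distrib]
        exact Finset.sum_congr rfl fun j _ => Finset.sum_congr rfl fun k _ => by ring
      rw [this, hz, hdot]; ring
    have hpn : ∀ j k, 0 ≤ p j k := fun j k => (mul_pos (hQ _) (Real.exp_pos _)).le
    have hdn : ∀ j k, |d.1 j + d.2 k| ≤ 2 * ‖d‖ := by
      intro j k
      have q1 := (norm_le_pi_norm d.1 j).trans (norm_fst_le d)
      have q2 := (norm_le_pi_norm d.2 k).trans (norm_snd_le d)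
      rw [Real.norm_eq_abs] at q1 q2
      linarith [abs_add_le (d.1 j) (d.2 k)]
    rw [hdot', norm_neg, norm_pow, norm_norm, Finset.sum_mul]
    refine (norm_sum_le _ _).trans (Finset.sum_le_sum fun j _ => ?_)
    rw [← a1 j, Finset.sum_mul, Finset.sum_mul]
    refine (norm_sum_le _ _).trans (Finset.sum_le_sum fun k _ => ?_)
    rw [norm_mul, Real.norm_eq_abs, Real.norm_eq_abs, abs_of_nonneg (hpn j k)]
    change p j k * _ ≤ p j k * 4 * ‖d‖ ^ 2
    rw [mul_assoc (p j k)]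
    refine mul_le_mul_of_nonneg_left ?_ (hpn j k)
    refine (Real.abs_exp_sub_one_sub_id_le (by linarith [hdn j k])).trans ?_
    rw [← sq_abs]
    have := pow_le_pow_left₀ (abs_nonneg _) (hdn j k) 2
    linarith
  have hO1 : ∀ x ∈ Mset K, (fun x' => Hreal K Q (αstar x') x' - Hreal K Q (αstar x) x +
            dotDV K (αstar x) (x' - x)) =O[nhdsWithin x
          {x' ∈ Mset K | (∑ j : Fin K, x'.1 j = ∑ j : Fin K, x.1 j) ∧
            ∑ k : Fin K, x'.2 k = ∑ k : Fin K, x.2 k}]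
          (fun x' => ‖x' - x‖ ^ 2) := by
    intro x hx
    have hsub : {x' ∈ Mset K | (∑ j : Fin K, x'.1 j = ∑ j : Fin K, x.1 j) ∧
            ∑ k : Fin K, x'.2 k = ∑ k : Fin K, x.2 k} ⊆ Mset K := fun y hy => hy.1
    have hlip := ((hder x hx).mono hsub).isBigO_sub
    have hprod : (fun x' => dotDV K (αstar x' - αstar x) (x' - x)) =O[nhdsWithin x
          {x' ∈ Mset K | (∑ j : Fin K, x'.1 j = ∑ j : Fin K, x.1 j) ∧
            ∑ k : Fin K, x'.2 k = ∑ k : Fin K, x.2 k}] (fun x' => ‖x' - x‖ ^ 2) := by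
      have h2 : (fun x' => ‖αstar x' - αstar x‖ * ‖x' - x‖) =O[nhdsWithin x
          {x' ∈ Mset K | (∑ j : Fin K, x'.1 j = ∑ j : Fin K, x.1 j) ∧
            ∑ k : Fin K, x'.2 k = ∑ k : Fin K, x.2 k}] (fun x' => ‖x' - x‖ ^ 2) := by
        simp only [pow_two]
        exact hlip.norm_norm.mul (isBigO_refl _ _)
      refine IsBigO.trans (IsBigO.of_bound (K + K : ℝ) (Eventually.of_forall fun y => ?_)) h2
      generalize αstar y - αstar x = a
      generalize y - x = b
      have t1 : ∀ u v : Fin K → ℝ, ‖∑ j, u j * v j‖ ≤ K * (‖u‖ * ‖v‖) := by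
        intro u v
        refine (norm_sum_le _ _).trans ?_
        refine (Finset.sum_le_card_nsmul _ _ (‖u‖ * ‖v‖) fun j _ => ?_).trans ?_
        · rw [norm_mul]
          exact mul_le_mul (norm_le_pi_norm u j) (norm_le_pi_norm v j) (norm_nonneg _)
            (norm_nonneg _)
        · simp
      have t2 : ‖a.1‖ * ‖b.1‖ ≤ ‖a‖ * ‖b‖ :=
        mul_le_mul (norm_fst_le a) (norm_fst_le b) (norm_nonneg _) (norm_nonneg _)
      have t3 : ‖a.2‖ * ‖b.2‖ ≤ ‖a‖ * ‖b‖ :=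
        mul_le_mul (norm_snd_le a) (norm_snd_le b) (norm_nonneg _) (norm_nonneg _)
      have hKn : (0:ℝ) ≤ K := Nat.cast_nonneg K
      rw [norm_mul, norm_norm, norm_norm, add_mul]
      exact (norm_add_le _ _).trans (add_le_add
        ((t1 a.1 b.1).trans (mul_le_mul_of_nonneg_left t2 hKn))
        ((t1 a.2 b.2).trans (mul_le_mul_of_nonneg_left t3 hKn)))
    refine ((hO2 x hx).add hprod).neg_left.congr' ?_ (EventuallyEq.refl _ _)
    filter_upwards [self_mem_nhdsWithin] with y hyS
    obtain ⟨hyM, hy1, hy2⟩ := hyS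
    obtain ⟨-, a1, a2⟩ := hαstar x hx
    obtain ⟨-, b1, b2⟩ := hαstar y hyM
    simp only [Hreal, dotDV, a1, b1, hy1, Prod.fst_sub, Prod.snd_sub, Pi.sub_apply, mul_sub,
      sub_mul, Finset.sum_sub_distrib]
    ring
  refine ⟨fun x => (fderiv ℝ (Fmap15 K Q) (αstar x)).inverse, ?_, hder, ?_,
    fun x hx => ⟨hO1 x hx, hO2 x hx⟩⟩
  · intro x hx
    obtain ⟨e, he⟩ := Fmap15_equiv hK Q hQ (αstar x)
    have h1 : ContinuousAt (ContinuousLinearMap.inverse :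
        (((Fin K → ℝ) × (Fin K → ℝ)) →L[ℝ] ((Fin K → ℝ) × (Fin K → ℝ))) → _)
        (fderiv ℝ (Fmap15 K Q) (αstar x)) := by
      rw [← he]
      exact (contDiffAt_map_inverse (n := 0) e).continuousAt
    have h2 : Continuous (fderiv ℝ (Fmap15 K Q)) :=
      (Fmap15_contDiff Q).continuous_fderiv (by norm_num)
    have h3 := (hder x hx).continuousWithinAt
    have h4 : ContinuousWithinAt (fun y => fderiv ℝ (Fmap15 K Q) (αstar y)) (Mset K) x :=
      ContinuousAt.comp_continuousWithinAt (f := αstar) (g := fderiv ℝ (Fmap15 K Q))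
        h2.continuousAt h3
    exact ContinuousAt.comp_continuousWithinAt
      (f := fun y => fderiv ℝ (Fmap15 K Q) (αstar y)) h1 h4
  · intro x hx v hv1 hv2
    constructor
    · have hcont : Continuous (fun t : ℝ => x + t • v) := by fun_prop
      have htend : Tendsto (fun t : ℝ => x + t • v) (nhds 0) (nhdsWithin x
          {x' ∈ Mset K | (∑ j : Fin K, x'.1 j = ∑ j : Fin K, x.1 j) ∧
            ∑ k : Fin K, x'.2 k = ∑ k : Fin K, x.2 k}) := by
        refine tendsto_nhdsWithin_iff.mpr ⟨?_, ?_⟩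
        · simpa using hcont.tendsto 0
        · have p1 : ∀ᶠ t : ℝ in nhds 0, ∀ j, 0 < (x + t • v).1 j := by
            rw [eventually_all]
            intro j
            have : Continuous (fun t : ℝ => (x + t • v).1 j) := by fun_prop
            exact (this.tendsto 0).eventually_const_lt (by simpa using hx.1 j)
          have p2 : ∀ᶠ t : ℝ in nhds 0, ∀ j, 0 < (x + t • v).2 j := by
            rw [eventually_all]
            intro j
            have : Continuous (fun t : ℝ => (x + t • v).2 j) := by fun_prop
            exact (this.tendsto 0).eventually_const_lt (by simpa using hx.2.1 j)
          filter_upwards [p1, p2] with t q1 q2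
          have s1 : ∑ j, (x + t • v).1 j = ∑ j, x.1 j := by
            simp [Finset.sum_add_distrib, ← Finset.mul_sum, hv1]
          have s2 : ∑ j, (x + t • v).2 j = ∑ j, x.2 j := by
            simp [Finset.sum_add_distrib, ← Finset.mul_sum, hv2]
          exact ⟨⟨q1, q2, by rw [s1, s2, hx.2.2]⟩, s1, s2⟩
      have h := (hO1 x hx).comp_tendsto htend
      rw [hasDerivAt_iff_isLittleO]
      have h' : (fun t : ℝ => Hreal K Q (αstar (x + t • v)) (x + t • v) - Hreal K Q (αstar x) x
          + t * dotDV K (αstar x) v) =O[nhds 0] (fun t : ℝ => t ^ 2) := by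
        refine (h.congr' ?_ (EventuallyEq.refl _ _)).trans ?_
        · refine Eventually.of_forall fun t => ?_
          simp only [Function.comp, add_sub_cancel_left]
          congr 1
          simp only [dotDV, Prod.smul_fst, Prod.smul_snd, Pi.smul_apply, smul_eq_mul, mul_add,
            Finset.mul_sum]
          congr 1 <;> exact Finset.sum_congr rfl fun j _ => by ring
        · refine IsBigO.of_bound (‖v‖ ^ 2) (Eventually.of_forall fun t => ?_)
          simp only [Function.comp, add_sub_cancel_left, norm_smul, norm_pow, norm_mul, norm_norm]
          exact le_of_eq (by ring)
      have h'' := h'.trans_isLittleO (isLittleO_pow_id (𝕜 := ℝ) (by norm_num : 1 < 2))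
      refine h''.congr ?_ ?_
      · intro t
        simp
      · intro t
        simp
    · obtain ⟨e, he⟩ := Fmap15_equiv hK Q hQ (αstar x)
      have hw : fderiv ℝ (Fmap15 K Q) (αstar x)
          ((fderiv ℝ (Fmap15 K Q) (αstar x)).inverse v) = v := by
        rw [← he, ContinuousLinearMap.inverse_equiv]
        simp
      change dotDV K ((fderiv ℝ (Fmap15 K Q) (αstar x)).inverse v) x = 0
      generalize (fderiv ℝ (Fmap15 K Q) (αstar x)).inverse v = w at hw
      rw [Fmap15_fderiv] at hw
      have hp := Prod.ext_iff.mp hw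
      have g1 : ∑ j, _ = _ := Finset.sum_congr (rfl : Finset.univ = Finset.univ)
        fun j _ => congrFun hp.1 j
      have g2 : ∑ j, _ = _ := Finset.sum_congr (rfl : Finset.univ = Finset.univ)
        fun j _ => congrFun hp.2 j
      rw [hv1] at g1
      rw [hv2] at g2
      simp only [Finset.sum_add_distrib, Finset.sum_sub_distrib] at g1 g2
      obtain ⟨-, a1, a2⟩ := hαstar x hx
      have hdot : dotDV K w x = ∑ j, ∑ k,
          Q (k, j) * Real.exp ((αstar x).1 j + (αstar x).2 k) * (w.1 j + w.2 k) := by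
        rw [← dot_double15 (fun j k => Q (k, j) * Real.exp ((αstar x).1 j + (αstar x).2 k))]
        simp only [dotDV, a1, a2]
      have hcomm := Finset.sum_comm (s := (Finset.univ : Finset (Fin K)))
        (t := (Finset.univ : Finset (Fin K)))
        (f := fun j k => Q (k, j) * Real.exp ((αstar x).1 j + (αstar x).2 k) * (w.1 j + w.2 k))
      rw [hdot]
      linarith
end

section
/- Consider N nodes with types (j_i, k_i) ∈ ℕ², E = ∑_i k_i = ∑_i j_i ≥ 1, the associated stub system, and the ACG wiring measure ℙ with weight function Q ≥ 0 and normalization C > 0. Fix ℓ₀ ∈ Fin E and a type (j₀, k₀) with e⁻_{j₀} ≥ 1 and e⁺_{k₀} ≥ 1. Then the probability that edge ℓ₀ is a self-loop at a node of type (j₀,k₀) — i.e. that out-stub σ(ℓ₀) and in-stub τ(ℓ₀) belong to the same node and that node has type (j₀,k₀) — equals ( j₀ · k₀ · u_{j₀k₀} / (e⁻_{j₀} · e⁺_{k₀}) ) · 𝔼[e_{k₀j₀}] / E, where u_{j₀k₀} = #{i : (j_i,k_i) = (j₀,k₀)} and 𝔼 is expectation under ℙ. -/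
open scoped BigOperators Classical

/-- Weighted mass of the wirings placing out-stub `a` and in-stub `b` on edge `ℓ₀`. -/
noncomputable def pairMass (E : ℕ) (k j : Fin E → ℕ) (Q : ℕ × ℕ → ℝ) (ℓ₀ a b : Fin E) : ℝ :=
  ∑ σ : Equiv.Perm (Fin E), ∑ τ : Equiv.Perm (Fin E),
    if σ ℓ₀ = a ∧ τ ℓ₀ = b then wiringWeight E k j Q σ τ else 0

lemma label_swap {E : ℕ} (k : Fin E → ℕ) {a a' : Fin E} (h : k a = k a') (x : Fin E) :
    k (Equiv.swap a a' x) = k x := by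
  rw [Equiv.swap_apply_def]
  split_ifs with h1 h2
  · rw [h1, h]
  · rw [h2, h]
  · rfl

lemma pairMass_congr (E : ℕ) (k j : Fin E → ℕ) (Q : ℕ × ℕ → ℝ) (ℓ₀ a b a' b' : Fin E)
    (ha : k a = k a') (hb : j b = j b') :
    pairMass E k j Q ℓ₀ a b = pairMass E k j Q ℓ₀ a' b' := by
  unfold pairMass
  refine Fintype.sum_equiv (Equiv.mulLeft (Equiv.swap a a')) _ _ fun σ => ?_
  refine Fintype.sum_equiv (Equiv.mulLeft (Equiv.swap b b')) _ _ fun τ => ?_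
  have h1 : wiringWeight E k j Q (Equiv.swap a a' * σ) (Equiv.swap b b' * τ)
      = wiringWeight E k j Q σ τ := by
    unfold wiringWeight
    refine Finset.prod_congr rfl fun ℓ _ => ?_
    rw [Equiv.Perm.mul_apply, Equiv.Perm.mul_apply, label_swap k ha, label_swap j hb]
  have h2 : ∀ c c' x : Fin E, Equiv.swap c c' x = c' ↔ x = c := by
    intro c c' x
    rw [Equiv.swap_apply_eq_iff, Equiv.swap_apply_right]
  simp only [Equiv.coe_mulLeft, h1, Equiv.Perm.mul_apply, h2]

lemma sum_event (E : ℕ) (k j : Fin E → ℕ) (Q : ℕ × ℕ → ℝ) (ℓ₀ a₀ b₀ : Fin E)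
    (P : Fin E → Fin E → Prop) [∀ a b, Decidable (P a b)] (hP : ∀ a b, P a b → k a = k a₀ ∧ j b = j b₀) :
    (∑ σ : Equiv.Perm (Fin E), ∑ τ : Equiv.Perm (Fin E),
      if P (σ ℓ₀) (τ ℓ₀) then wiringWeight E k j Q σ τ else 0) =
    (∑ a : Fin E, ∑ b : Fin E, if P a b then (1 : ℝ) else 0) * pairMass E k j Q ℓ₀ a₀ b₀ := by
  have h : ∀ a b, (if P a b then (1 : ℝ) else 0) * pairMass E k j Q ℓ₀ a₀ b₀ =
      ∑ σ : Equiv.Perm (Fin E), ∑ τ : Equiv.Perm (Fin E),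
        if P a b then (if σ ℓ₀ = a ∧ τ ℓ₀ = b then wiringWeight E k j Q σ τ else 0) else 0 := by
    intro a b
    split_ifs with hab
    · rw [one_mul, pairMass_congr E k j Q ℓ₀ a₀ b₀ a b (hP a b hab).1.symm (hP a b hab).2.symm]
      rfl
    · simp
  simp only [Finset.sum_mul, h]
  symm
  calc _ = ∑ a : Fin E, ∑ σ : Equiv.Perm (Fin E), ∑ b : Fin E, ∑ τ : Equiv.Perm (Fin E),
        (if P a b then (if σ ℓ₀ = a ∧ τ ℓ₀ = b then wiringWeight E k j Q σ τ else 0) else 0) :=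
        Finset.sum_congr rfl fun a _ => Finset.sum_comm
    _ = ∑ σ : Equiv.Perm (Fin E), ∑ a : Fin E, ∑ τ : Equiv.Perm (Fin E), ∑ b : Fin E,
        (if P a b then (if σ ℓ₀ = a ∧ τ ℓ₀ = b then wiringWeight E k j Q σ τ else 0) else 0) := by
        rw [Finset.sum_comm]
        exact Finset.sum_congr rfl fun σ _ => Finset.sum_congr rfl fun a _ => Finset.sum_comm
    _ = _ := by
        refine Finset.sum_congr rfl fun σ _ => ?_
        rw [Finset.sum_comm]
        refine Finset.sum_congr rfl fun τ _ => ?_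
        rw [Finset.sum_eq_single (σ ℓ₀), Finset.sum_eq_single (τ ℓ₀)]
        · simp
        · intro b _ hb
          simp [Ne.symm hb]
        · simp
        · intro a _ ha
          simp [Ne.symm ha]
        · simp

lemma event_edge_indep (E : ℕ) (k j : Fin E → ℕ) (Q : ℕ × ℕ → ℝ) (ℓ₀ ℓ : Fin E)
    (P : Fin E → Fin E → Prop) [∀ a b, Decidable (P a b)] :
    (∑ σ : Equiv.Perm (Fin E), ∑ τ : Equiv.Perm (Fin E),
      if P (σ ℓ) (τ ℓ) then wiringWeight E k j Q σ τ else 0) =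
    ∑ σ : Equiv.Perm (Fin E), ∑ τ : Equiv.Perm (Fin E),
      if P (σ ℓ₀) (τ ℓ₀) then wiringWeight E k j Q σ τ else 0 := by
  refine Fintype.sum_equiv (Equiv.mulRight (Equiv.swap ℓ ℓ₀)) _ _ fun σ => ?_
  refine Fintype.sum_equiv (Equiv.mulRight (Equiv.swap ℓ ℓ₀)) _ _ fun τ => ?_
  have h1 : wiringWeight E k j Q (σ * Equiv.swap ℓ ℓ₀) (τ * Equiv.swap ℓ ℓ₀)
      = wiringWeight E k j Q σ τ := by
    unfold wiringWeight
    exact Fintype.prod_equiv (Equiv.swap ℓ ℓ₀) _ _ fun x => rfl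
  simp only [Equiv.coe_mulRight, h1, Equiv.Perm.mul_apply, Equiv.swap_apply_right]

lemma sum_edgeTypeCount (E : ℕ) (k j : Fin E → ℕ) (Q : ℕ × ℕ → ℝ) (ℓ₀ : Fin E) (k₀ j₀ : ℕ) :
    (∑ σ : Equiv.Perm (Fin E), ∑ τ : Equiv.Perm (Fin E),
      (edgeTypeCount E k j σ τ k₀ j₀ : ℝ) * wiringWeight E k j Q σ τ) =
    E * ∑ σ : Equiv.Perm (Fin E), ∑ τ : Equiv.Perm (Fin E),
      if k (σ ℓ₀) = k₀ ∧ j (τ ℓ₀) = j₀ then wiringWeight E k j Q σ τ else 0 := by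
  have h : ∀ σ τ : Equiv.Perm (Fin E),
      (edgeTypeCount E k j σ τ k₀ j₀ : ℝ) * wiringWeight E k j Q σ τ =
      ∑ ℓ : Fin E, if k (σ ℓ) = k₀ ∧ j (τ ℓ) = j₀ then wiringWeight E k j Q σ τ else 0 := by
    intro σ τ
    rw [← Finset.sum_filter, Finset.sum_const, nsmul_eq_mul]
    unfold edgeTypeCount
    congr!
  simp only [h]
  calc _ = ∑ σ : Equiv.Perm (Fin E), ∑ ℓ : Fin E, ∑ τ : Equiv.Perm (Fin E),
        (if k (σ ℓ) = k₀ ∧ j (τ ℓ) = j₀ then wiringWeight E k j Q σ τ else 0) :=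
        Finset.sum_congr rfl fun σ _ => Finset.sum_comm
    _ = _ := by
        rw [Finset.sum_comm]
        rw [Finset.sum_congr rfl fun ℓ _ =>
          event_edge_indep E k j Q ℓ₀ ℓ (fun a b => k a = k₀ ∧ j b = j₀)]
        simp

lemma count_type (E : ℕ) (k j : Fin E → ℕ) (k₀ j₀ : ℕ) :
    (∑ a : Fin E, ∑ b : Fin E, if k a = k₀ ∧ j b = j₀ then (1 : ℝ) else 0) =
      (stubCount E j j₀ : ℝ) * (stubCount E k k₀ : ℝ) := by
  have h : ∀ a b, (if k a = k₀ ∧ j b = j₀ then (1 : ℝ) else 0) =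
      (if k a = k₀ then 1 else 0) * (if j b = j₀ then 1 else 0) := by
    intro a b
    by_cases h1 : k a = k₀ <;> by_cases h2 : j b = j₀ <;> simp [h1, h2]
  simp only [h]
  rw [← Finset.sum_mul_sum, mul_comm]
  unfold stubCount
  simp

lemma count_loop (N E : ℕ) (jdeg kdeg : Fin N → ℕ) (nodeOut nodeIn : Fin E → Fin N)
    (hOut : ∀ i, (Finset.univ.filter fun ℓ => nodeOut ℓ = i).card = kdeg i)
    (hIn : ∀ i, (Finset.univ.filter fun ℓ => nodeIn ℓ = i).card = jdeg i) (j₀ k₀ : ℕ) :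
    (∑ a : Fin E, ∑ b : Fin E, if nodeOut a = nodeIn b ∧ jdeg (nodeOut a) = j₀ ∧
        kdeg (nodeOut a) = k₀ then (1 : ℝ) else 0) =
      (j₀ : ℝ) * (k₀ : ℝ) *
        ((Finset.univ.filter fun i : Fin N => jdeg i = j₀ ∧ kdeg i = k₀).card : ℝ) := by
  have h1 : ∀ a, (∑ b : Fin E, if nodeOut a = nodeIn b ∧ jdeg (nodeOut a) = j₀ ∧
        kdeg (nodeOut a) = k₀ then (1 : ℝ) else 0) =
      if jdeg (nodeOut a) = j₀ ∧ kdeg (nodeOut a) = k₀ then (j₀ : ℝ) else 0 := by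
    intro a
    by_cases h : jdeg (nodeOut a) = j₀ ∧ kdeg (nodeOut a) = k₀
    · have := hIn (nodeOut a)
      rw [h.1] at this
      simp only [h, and_true, if_true, eq_comm (a := nodeOut a), ← this]
      simp
    · simp [h]
  simp only [h1]
  rw [← Finset.sum_fiberwise (s := Finset.univ) (g := nodeOut)]
  have h2 : ∀ i : Fin N, (∑ a ∈ Finset.univ.filter (fun a => nodeOut a = i),
      if jdeg (nodeOut a) = j₀ ∧ kdeg (nodeOut a) = k₀ then (j₀ : ℝ) else 0) =
      if jdeg i = j₀ ∧ kdeg i = k₀ then (j₀ : ℝ) * k₀ else 0 := by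
    intro i
    rw [Finset.sum_congr rfl (g := fun _ => if jdeg i = j₀ ∧ kdeg i = k₀ then (j₀ : ℝ) else 0)
      (by intro a ha; rw [(Finset.mem_filter.1 ha).2])]
    rw [Finset.sum_const, nsmul_eq_mul, hOut]
    split_ifs with h
    · rw [h.2, mul_comm]
    · simp
  simp only [h2]
  rw [← Finset.sum_filter, Finset.sum_const, nsmul_eq_mul, mul_comm]

/-- In the node-based ACG model, the probability that edge `ℓ₀` is a
self-loop at a node of type `(j₀,k₀)` equals
`(j₀ k₀ u_{j₀k₀} / (e⁻_{j₀} e⁺_{k₀})) · 𝔼[e_{k₀j₀}] / E`. -/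
theorem stmt17 (N E : ℕ) (hE : 1 ≤ E) (jdeg kdeg : Fin N → ℕ)
    (nodeOut nodeIn : Fin E → Fin N)
    (hOut : ∀ i, (Finset.univ.filter fun ℓ => nodeOut ℓ = i).card = kdeg i)
    (hIn : ∀ i, (Finset.univ.filter fun ℓ => nodeIn ℓ = i).card = jdeg i)
    (Q : ℕ × ℕ → ℝ) (hQ : ∀ p, 0 ≤ Q p)
    (hC : 0 < Cnorm E (fun ℓ => kdeg (nodeOut ℓ)) (fun ℓ => jdeg (nodeIn ℓ)) Q)
    (ℓ₀ : Fin E) (j₀ k₀ : ℕ)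
    (hjm : 1 ≤ stubCount E (fun ℓ => jdeg (nodeIn ℓ)) j₀)
    (hkm : 1 ≤ stubCount E (fun ℓ => kdeg (nodeOut ℓ)) k₀) :
    (∑ σ : Equiv.Perm (Fin E), ∑ τ : Equiv.Perm (Fin E),
        if nodeOut (σ ℓ₀) = nodeIn (τ ℓ₀) ∧ jdeg (nodeOut (σ ℓ₀)) = j₀ ∧
            kdeg (nodeOut (σ ℓ₀)) = k₀
          then wiringWeight E (fun ℓ => kdeg (nodeOut ℓ)) (fun ℓ => jdeg (nodeIn ℓ)) Q σ τ
          else 0) /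
        Cnorm E (fun ℓ => kdeg (nodeOut ℓ)) (fun ℓ => jdeg (nodeIn ℓ)) Q =
      ((j₀ : ℝ) * (k₀ : ℝ) *
          ((Finset.univ.filter fun i : Fin N => jdeg i = j₀ ∧ kdeg i = k₀).card : ℝ) /
          ((stubCount E (fun ℓ => jdeg (nodeIn ℓ)) j₀ : ℝ) *
            (stubCount E (fun ℓ => kdeg (nodeOut ℓ)) k₀ : ℝ))) *
        expectEdge E (fun ℓ => kdeg (nodeOut ℓ)) (fun ℓ => jdeg (nodeIn ℓ)) Q k₀ j₀ /
        (E : ℝ) := by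
  obtain ⟨b₀, hb₀⟩ := Finset.card_pos.1 hjm
  obtain ⟨a₀, ha₀⟩ := Finset.card_pos.1 hkm
  have hb := (Finset.mem_filter.1 hb₀).2
  have ha := (Finset.mem_filter.1 ha₀).2
  have hS := sum_event E (fun ℓ => kdeg (nodeOut ℓ)) (fun ℓ => jdeg (nodeIn ℓ)) Q ℓ₀ a₀ b₀
    (fun a b => nodeOut a = nodeIn b ∧ jdeg (nodeOut a) = j₀ ∧ kdeg (nodeOut a) = k₀)
    (by
      rintro a b ⟨h1, h2, h3⟩
      exact ⟨h3.trans ha.symm, (h1 ▸ h2).trans hb.symm⟩)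
  have hT := sum_event E (fun ℓ => kdeg (nodeOut ℓ)) (fun ℓ => jdeg (nodeIn ℓ)) Q ℓ₀ a₀ b₀
    (fun a b => kdeg (nodeOut a) = k₀ ∧ jdeg (nodeIn b) = j₀)
    (by
      rintro a b ⟨h1, h2⟩
      exact ⟨h1.trans ha.symm, h2.trans hb.symm⟩)
  have hcl := count_loop N E jdeg kdeg nodeOut nodeIn hOut hIn j₀ k₀
  have hct := count_type E (fun ℓ => kdeg (nodeOut ℓ)) (fun ℓ => jdeg (nodeIn ℓ)) k₀ j₀
  have hse := sum_edgeTypeCount E (fun ℓ => kdeg (nodeOut ℓ)) (fun ℓ => jdeg (nodeIn ℓ)) Q ℓ₀ k₀ j₀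
  unfold expectEdge
  rw [hse]
  have hS' := hS.trans (congrArg (· * _) hcl)
  have hT' := hT.trans (congrArg (· * _) hct)
  have hj0 : (stubCount E (fun ℓ => jdeg (nodeIn ℓ)) j₀ : ℝ) ≠ 0 := by
    exact_mod_cast (by omega : stubCount E (fun ℓ => jdeg (nodeIn ℓ)) j₀ ≠ 0)
  have hk0 : (stubCount E (fun ℓ => kdeg (nodeOut ℓ)) k₀ : ℝ) ≠ 0 := by
    exact_mod_cast (by omega : stubCount E (fun ℓ => kdeg (nodeOut ℓ)) k₀ ≠ 0)
  have hE0 : (E : ℝ) ≠ 0 := by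
    exact_mod_cast (by omega : E ≠ 0)
  have hC0 := hC.ne'
  refine (congrArg (· / _) hS').trans ?_
  refine Eq.trans ?_ (congrArg (fun t => _ * (_ * t / _) / _) hT').symm
  beta_reduce
  generalize pairMass E _ _ Q ℓ₀ a₀ b₀ = A at *
  field_simp
end

section
/- Consider N nodes with types (j_i, k_i) ∈ ℕ², E = ∑_i k_i = ∑_i j_i ≥ 1, the associated stub system, and the ACG wiring measure ℙ with weight function Q ≥ 0 and normalization C > 0. Fix ℓ₀ ∈ Fin E and node types (j₁, k₁), (j₂, k₂) with e⁻_{j₁} ≥ 1 and e⁺_{k₂} ≥ 1. Then the probability that, in edge ℓ₀, the creditor node (owner of in-stub τ(ℓ₀)) has type (j₁, k₁) and the debtor node (owner of out-stub σ(ℓ₀)) has type (j₂, k₂) equals ( j₁ · u_{j₁k₁} · k₂ · u_{j₂k₂} / (e⁻_{j₁} · e⁺_{k₂}) ) · 𝔼[e_{k₂j₁}] / E, where u_{j'k'} = #{i : (j_i,k_i) = (j',k')} and 𝔼 is expectation under ℙ. -/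
open scoped BigOperators Classical

theorem sym_aux {E : ℕ} (k : Fin E → ℕ) (f : Equiv.Perm (Fin E) → ℝ)
    (hf : ∀ a a' σ, k a = k a' → f (Equiv.swap a a' * σ) = f σ)
    (ℓ : Fin E) (d : ℕ) (P : Fin E → Prop) [DecidablePred P] (hP : ∀ a, P a → k a = d) :
    (stubCount E k d : ℝ) * ∑ σ : Equiv.Perm (Fin E), (if P (σ ℓ) then f σ else 0) =
      ((Finset.univ.filter P).card : ℝ) *
        ∑ σ : Equiv.Perm (Fin E), (if k (σ ℓ) = d then f σ else 0) := by
  have hB : ∀ a a', k a = k a' →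
      ∑ σ : Equiv.Perm (Fin E), (if σ ℓ = a then f σ else 0) =
      ∑ σ : Equiv.Perm (Fin E), (if σ ℓ = a' then f σ else 0) := by
    intro a a' h
    refine Fintype.sum_equiv (Equiv.mulLeft (Equiv.swap a a')) _ _ ?_
    intro σ
    have h1 : (Equiv.swap a a') (σ ℓ) = a' ↔ σ ℓ = a := by
      rw [← Equiv.eq_symm_apply]; simp
    simp only [Equiv.coe_mulLeft, Equiv.Perm.mul_apply, h1, hf a a' σ h]
  have hS : ∀ (R : Fin E → Prop) [DecidablePred R], ∑ σ : Equiv.Perm (Fin E), (if R (σ ℓ) then f σ else 0) =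
      ∑ a ∈ Finset.univ.filter R,
        ∑ σ : Equiv.Perm (Fin E), (if σ ℓ = a then f σ else 0) := by
    intro R _
    rw [Finset.sum_comm]
    refine Finset.sum_congr rfl fun σ _ => ?_
    rw [Finset.sum_ite_eq]
    simp
  rw [hS P, hS (fun a => k a = d)]
  unfold stubCount
  rw [← nsmul_eq_mul, ← nsmul_eq_mul, ← Finset.sum_const, ← Finset.sum_const, Finset.sum_comm]
  refine Finset.sum_congr rfl fun a ha => Finset.sum_congr rfl fun b hb => hB _ _ ?_
  simp only [Finset.mem_filter, Finset.mem_univ, true_and] at ha hb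
  rw [hP a ha, hb]

theorem comp_swap_aux {E : ℕ} (k : Fin E → ℕ) (a a' x : Fin E) (h : k a = k a') :
    k (Equiv.swap a a' x) = k x := by
  rw [Equiv.swap_apply_def]
  split_ifs with h1 h2
  · rw [h1, h]
  · rw [h2, h]
  · rfl

theorem edge_aux {E : ℕ} (k j : Fin E → ℕ) (Q : ℕ × ℕ → ℝ) (ℓ₀ : Fin E) (k₀ j₀ : ℕ) :
    (∑ σ : Equiv.Perm (Fin E), ∑ τ : Equiv.Perm (Fin E),
      (edgeTypeCount E k j σ τ k₀ j₀ : ℝ) * wiringWeight E k j Q σ τ) =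
    (E : ℝ) * ∑ σ : Equiv.Perm (Fin E), ∑ τ : Equiv.Perm (Fin E),
      if k (σ ℓ₀) = k₀ ∧ j (τ ℓ₀) = j₀ then wiringWeight E k j Q σ τ else 0 := by
  have h1 : ∀ ℓ : Fin E, (∑ σ : Equiv.Perm (Fin E), ∑ τ : Equiv.Perm (Fin E),
      if k (σ ℓ) = k₀ ∧ j (τ ℓ) = j₀ then wiringWeight E k j Q σ τ else 0) =
      ∑ σ : Equiv.Perm (Fin E), ∑ τ : Equiv.Perm (Fin E),
      if k (σ ℓ₀) = k₀ ∧ j (τ ℓ₀) = j₀ then wiringWeight E k j Q σ τ else 0 := by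
    intro ℓ
    refine Fintype.sum_equiv (Equiv.mulRight (Equiv.swap ℓ ℓ₀)) _ _ fun σ => ?_
    refine Fintype.sum_equiv (Equiv.mulRight (Equiv.swap ℓ ℓ₀)) _ _ fun τ => ?_
    have hw : wiringWeight E k j Q (σ * Equiv.swap ℓ ℓ₀) (τ * Equiv.swap ℓ ℓ₀) =
        wiringWeight E k j Q σ τ := by
      unfold wiringWeight
      exact Fintype.prod_equiv (Equiv.swap ℓ ℓ₀) _ _ fun x => rfl
    simp only [Equiv.coe_mulRight, Equiv.Perm.mul_apply, hw, Equiv.swap_apply_right]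
  have h2 : ∑ ℓ : Fin E, (∑ σ : Equiv.Perm (Fin E), ∑ τ : Equiv.Perm (Fin E),
      if k (σ ℓ) = k₀ ∧ j (τ ℓ) = j₀ then wiringWeight E k j Q σ τ else 0) =
      ∑ _ℓ : Fin E, ∑ σ : Equiv.Perm (Fin E), ∑ τ : Equiv.Perm (Fin E),
      if k (σ ℓ₀) = k₀ ∧ j (τ ℓ₀) = j₀ then wiringWeight E k j Q σ τ else 0 :=
    Finset.sum_congr rfl fun ℓ _ => h1 ℓ
  rw [Finset.sum_const, Finset.card_univ, Fintype.card_fin, nsmul_eq_mul] at h2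
  rw [← h2]
  refine Eq.trans ?_ Finset.sum_comm
  refine Finset.sum_congr rfl fun σ _ => ?_
  refine Eq.trans ?_ Finset.sum_comm
  refine Finset.sum_congr rfl fun τ _ => ?_
  rw [← Finset.sum_filter, Finset.sum_const, nsmul_eq_mul]
  unfold edgeTypeCount
  congr!

theorem card_aux {N E : ℕ} (node : Fin E → Fin N) (deg : Fin N → ℕ)
    (h : ∀ i, (Finset.univ.filter fun ℓ => node ℓ = i).card = deg i)
    (P : Fin N → Prop) [DecidablePred P] (d : ℕ) (hP : ∀ i, P i → deg i = d) :
    (Finset.univ.filter fun ℓ => P (node ℓ)).card = d * (Finset.univ.filter P).card := by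
  rw [Finset.card_eq_sum_card_fiberwise (f := node) (t := Finset.univ.filter P)
    (by intro x hx; simpa using hx)]
  rw [Finset.sum_congr rfl (g := fun _ => d)]
  · simp [mul_comm]
  · intro i hi
    have hi' : P i := by simpa using hi
    rw [← hP i hi', ← h i]
    congr 1
    ext x
    simp only [Finset.mem_filter, Finset.mem_univ, true_and]
    constructor
    · exact fun hx => hx.2
    · exact fun hx => ⟨hx ▸ hi', hx⟩

/-- In the node-based ACG model, the probability that in edge `ℓ₀` the
creditor node has type `(j₁,k₁)` and the debtor node has type `(j₂,k₂)` equals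
`(j₁ u_{j₁k₁} k₂ u_{j₂k₂} / (e⁻_{j₁} e⁺_{k₂})) · 𝔼[e_{k₂j₁}] / E`. -/
theorem stmt18 (N E : ℕ) (hE : 1 ≤ E) (jdeg kdeg : Fin N → ℕ)
    (nodeOut nodeIn : Fin E → Fin N)
    (hOut : ∀ i, (Finset.univ.filter fun ℓ => nodeOut ℓ = i).card = kdeg i)
    (hIn : ∀ i, (Finset.univ.filter fun ℓ => nodeIn ℓ = i).card = jdeg i)
    (Q : ℕ × ℕ → ℝ) (hQ : ∀ p, 0 ≤ Q p)
    (hC : 0 < Cnorm E (fun ℓ => kdeg (nodeOut ℓ)) (fun ℓ => jdeg (nodeIn ℓ)) Q)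
    (ℓ₀ : Fin E) (j₁ k₁ j₂ k₂ : ℕ)
    (hjm : 1 ≤ stubCount E (fun ℓ => jdeg (nodeIn ℓ)) j₁)
    (hkm : 1 ≤ stubCount E (fun ℓ => kdeg (nodeOut ℓ)) k₂) :
    (∑ σ : Equiv.Perm (Fin E), ∑ τ : Equiv.Perm (Fin E),
        if jdeg (nodeIn (τ ℓ₀)) = j₁ ∧ kdeg (nodeIn (τ ℓ₀)) = k₁ ∧
            jdeg (nodeOut (σ ℓ₀)) = j₂ ∧ kdeg (nodeOut (σ ℓ₀)) = k₂
          then wiringWeight E (fun ℓ => kdeg (nodeOut ℓ)) (fun ℓ => jdeg (nodeIn ℓ)) Q σ τ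
          else 0) /
        Cnorm E (fun ℓ => kdeg (nodeOut ℓ)) (fun ℓ => jdeg (nodeIn ℓ)) Q =
      ((j₁ : ℝ) * ((Finset.univ.filter fun i : Fin N => jdeg i = j₁ ∧ kdeg i = k₁).card : ℝ) *
          (k₂ : ℝ) * ((Finset.univ.filter fun i : Fin N => jdeg i = j₂ ∧ kdeg i = k₂).card : ℝ) /
          ((stubCount E (fun ℓ => jdeg (nodeIn ℓ)) j₁ : ℝ) *
            (stubCount E (fun ℓ => kdeg (nodeOut ℓ)) k₂ : ℝ))) *
        expectEdge E (fun ℓ => kdeg (nodeOut ℓ)) (fun ℓ => jdeg (nodeIn ℓ)) Q k₂ j₁ /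
        (E : ℝ) := by
  unfold expectEdge
  rw [edge_aux _ _ _ ℓ₀]
  have c1 := card_aux nodeIn jdeg hIn (fun i => jdeg i = j₁ ∧ kdeg i = k₁) j₁ (fun i h => h.1)
  have c2 := card_aux nodeOut kdeg hOut (fun i => jdeg i = j₂ ∧ kdeg i = k₂) k₂ (fun i h => h.2)
  set k : Fin E → ℕ := fun ℓ => kdeg (nodeOut ℓ) with hk
  set j : Fin E → ℕ := fun ℓ => jdeg (nodeIn ℓ) with hj
  have wk : ∀ a a' σ τ, k a = k a' →
      wiringWeight E k j Q (Equiv.swap a a' * σ) τ = wiringWeight E k j Q σ τ := by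
    intro a a' σ τ h
    unfold wiringWeight
    exact Finset.prod_congr rfl fun x _ => by
      rw [Equiv.Perm.mul_apply, comp_swap_aux k a a' _ h]
  have wj : ∀ a a' σ τ, j a = j a' →
      wiringWeight E k j Q σ (Equiv.swap a a' * τ) = wiringWeight E k j Q σ τ := by
    intro a a' σ τ h
    unfold wiringWeight
    exact Finset.prod_congr rfl fun x _ => by
      rw [Equiv.Perm.mul_apply, comp_swap_aux j a a' _ h]
  have s2 := sym_aux k (fun σ => ∑ τ : Equiv.Perm (Fin E),
      if jdeg (nodeIn (τ ℓ₀)) = j₁ ∧ kdeg (nodeIn (τ ℓ₀)) = k₁ then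
        wiringWeight E k j Q σ τ else 0)
    (by intro a a' σ h; simp only [wk a a' σ _ h]) ℓ₀ k₂
    (fun a => jdeg (nodeOut a) = j₂ ∧ kdeg (nodeOut a) = k₂) (fun a h => h.2)
  have s1 := sym_aux j (fun τ => ∑ σ : Equiv.Perm (Fin E),
      if k (σ ℓ₀) = k₂ then wiringWeight E k j Q σ τ else 0)
    (by intro a a' τ h; simp only [wj a a' _ τ h]) ℓ₀ j₁
    (fun a => jdeg (nodeIn a) = j₁ ∧ kdeg (nodeIn a) = k₁) (fun a h => h.1)
  rw [c2] at s2
  rw [c1] at s1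
  have e0 : (∑ σ : Equiv.Perm (Fin E), ∑ τ : Equiv.Perm (Fin E),
        if jdeg (nodeIn (τ ℓ₀)) = j₁ ∧ kdeg (nodeIn (τ ℓ₀)) = k₁ ∧
            jdeg (nodeOut (σ ℓ₀)) = j₂ ∧ kdeg (nodeOut (σ ℓ₀)) = k₂
          then wiringWeight E k j Q σ τ else 0) =
      ∑ σ : Equiv.Perm (Fin E),
        if jdeg (nodeOut (σ ℓ₀)) = j₂ ∧ kdeg (nodeOut (σ ℓ₀)) = k₂ then
        (∑ τ : Equiv.Perm (Fin E),
          if jdeg (nodeIn (τ ℓ₀)) = j₁ ∧ kdeg (nodeIn (τ ℓ₀)) = k₁ then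
          wiringWeight E k j Q σ τ else 0) else 0 := by
    refine Finset.sum_congr rfl fun σ _ => ?_
    by_cases h : jdeg (nodeOut (σ ℓ₀)) = j₂ ∧ kdeg (nodeOut (σ ℓ₀)) = k₂
    · rw [if_pos h]
      refine Finset.sum_congr rfl fun τ _ => if_congr ?_ rfl rfl
      tauto
    · rw [if_neg h]
      exact Finset.sum_eq_zero fun τ _ => if_neg (by tauto)
  have e1 : (∑ σ : Equiv.Perm (Fin E), if k (σ ℓ₀) = k₂ then
        (∑ τ : Equiv.Perm (Fin E),
          if jdeg (nodeIn (τ ℓ₀)) = j₁ ∧ kdeg (nodeIn (τ ℓ₀)) = k₁ then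
          wiringWeight E k j Q σ τ else 0) else 0) =
      ∑ τ : Equiv.Perm (Fin E),
        if jdeg (nodeIn (τ ℓ₀)) = j₁ ∧ kdeg (nodeIn (τ ℓ₀)) = k₁ then
        (∑ σ : Equiv.Perm (Fin E), if k (σ ℓ₀) = k₂ then
          wiringWeight E k j Q σ τ else 0) else 0 := by
    simp only [← Finset.sum_filter]
    rw [Finset.sum_comm]
  have e2 : (∑ τ : Equiv.Perm (Fin E), if j (τ ℓ₀) = j₁ then
        (∑ σ : Equiv.Perm (Fin E), if k (σ ℓ₀) = k₂ then
          wiringWeight E k j Q σ τ else 0) else 0) =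
      ∑ σ : Equiv.Perm (Fin E), ∑ τ : Equiv.Perm (Fin E),
      if k (σ ℓ₀) = k₂ ∧ j (τ ℓ₀) = j₁ then wiringWeight E k j Q σ τ else 0 := by
    rw [Finset.sum_comm]
    refine Finset.sum_congr rfl fun τ _ => ?_
    by_cases h : j (τ ℓ₀) = j₁ <;> simp [h]
  rw [e0]
  rw [e1] at s2
  rw [e2] at s1
  have hE' : (E : ℝ) ≠ 0 := by positivity
  have hj' : (stubCount E j j₁ : ℝ) ≠ 0 := by positivity
  have hk' : (stubCount E k k₂ : ℝ) ≠ 0 := by positivity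
  push_cast at s1 s2
  rw [mul_comm, ← eq_div_iff hk'] at s2
  rw [mul_comm, ← eq_div_iff hj'] at s1
  rw [s1] at s2
  rw [s2]
  field_simp
  rfl
end
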